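/- Let μ ∈ (0,1) and let c < c₁(μ), where c₁(μ) is the first critical value. Then there exists at least one consecutive collision orbit with energy c, i.e. there exist τ > 0 and a C² solution q : (0,τ) → 𝒦_c of the PCR3BP system with energy c such that lim_{t→0⁺} q(t) = O = lim_{t→τ⁻} q(t). -/

import Mathlib

open Set Filter

/-- Euclidean norm on `ℝ × ℝ`. -/
noncomputable def nrm (v : ℝ × ℝ) : ℝ := Real.sqrt (v.1 ^ 2 + v.2 ^ 2)

/-- Effective potential of the PCR3BP with mass ratio `μ`; the primary `O = (0,0)`
has mass `1 - μ` and the primary `E = (1,0)` has mass `μ`. -/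
noncomputable def V (μ : ℝ) (q : ℝ × ℝ) : ℝ :=
  -(((q.1 - μ) ^ 2 + q.2 ^ 2) / 2) - μ / nrm (q.1 - 1, q.2) - (1 - μ) / nrm q

/-- Critical points of the effective potential. -/
def critSet (μ : ℝ) : Set (ℝ × ℝ) :=
  {q | q ≠ (0, 0) ∧ q ≠ (1, 0) ∧ fderiv ℝ (V μ) q = 0}

/-- The first critical value `c₁(μ)`: the minimum of `V` over its critical points. -/
noncomputable def firstCriticalValue (μ : ℝ) : ℝ := sInf (V μ '' critSet μ)

/-- The Hill region at energy `c`. -/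
def Hill (μ c : ℝ) : Set (ℝ × ℝ) := {q | q ≠ (0, 0) ∧ q ≠ (1, 0) ∧ V μ q ≤ c}

/-- `𝒦_c`: the connected component of the Hill region whose closure contains `O = (0,0)`. -/
def KSet (μ c : ℝ) : Set (ℝ × ℝ) :=
  {q | q ∈ Hill μ c ∧ (0, 0) ∈ closure (connectedComponentIn (Hill μ c) q)}

/-- A consecutive collision orbit with energy `c`: a `C²` solution `q : (0,τ) → 𝒦_c` of
`q̈₁ - 2q̇₂ = -∂V/∂q₁`, `q̈₂ + 2q̇₁ = -∂V/∂q₂` with energy `c`, tending to `O` at both ends. -/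
def IsCCO (μ c : ℝ) (τ : ℝ) (q : ℝ → ℝ × ℝ) : Prop :=
  0 < τ ∧ ∃ q' q'' : ℝ → ℝ × ℝ,
    (∀ t ∈ Ioo (0 : ℝ) τ, HasDerivAt q (q' t) t) ∧
    (∀ t ∈ Ioo (0 : ℝ) τ, HasDerivAt q' (q'' t) t) ∧
    ContinuousOn q'' (Ioo (0 : ℝ) τ) ∧
    (∀ t ∈ Ioo (0 : ℝ) τ, q t ∈ KSet μ c) ∧
    (∀ t ∈ Ioo (0 : ℝ) τ,
      (q'' t).1 - 2 * (q' t).2 = -((fderiv ℝ (V μ) (q t)) (1, 0)) ∧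
      (q'' t).2 + 2 * (q' t).1 = -((fderiv ℝ (V μ) (q t)) (0, 1))) ∧
    (∀ t ∈ Ioo (0 : ℝ) τ, nrm (q' t) ^ 2 / 2 + V μ (q t) = c) ∧
    Tendsto q (nhdsWithin 0 (Ioi 0)) (nhds (0, 0)) ∧
    Tendsto q (nhdsWithin τ (Iio τ)) (nhds (0, 0))

section ODE

open Topology

variable {E : Type*} [NormedAddCommGroup E] [NormedSpace ℝ E]

/-- `γ` is an integral curve of `X` on `[0, T]` inside `Ω`. -/
def IsSol (X : E → E) (Ω : Set E) (T : ℝ) (γ : ℝ → E) : Prop :=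
  ∀ t ∈ Icc 0 T, γ t ∈ Ω ∧ HasDerivAt γ (X (γ t)) t

theorem IsSol.mono {X : E → E} {Ω : Set E} {T T' : ℝ} {γ : ℝ → E} (h : IsSol X Ω T γ)
    (hT : T' ≤ T) : IsSol X Ω T' γ := fun t ht => h t ⟨ht.1, ht.2.trans hT⟩

theorem IsSol.continuousOn {X : E → E} {Ω : Set E} {T : ℝ} {γ : ℝ → E} (h : IsSol X Ω T γ) :
    ContinuousOn γ (Icc 0 T) := fun t ht => (h t ht).2.continuousAt.continuousWithinAt

variable [FiniteDimensional ℝ E]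

/-- A `C¹` vector field can be cut off outside a neighbourhood of a compact set. -/
theorem exists_cutoff {X : E → E} {Ω K : Set E} (hΩ : IsOpen Ω) (hX : ContDiffOn ℝ 1 X Ω)
    (hK : IsCompact K) (hKΩ : K ⊆ Ω) :
    ∃ Y : E → E, ContDiff ℝ 1 Y ∧ HasCompactSupport Y ∧
      ∃ U, IsOpen U ∧ K ⊆ U ∧ U ⊆ Ω ∧ EqOn Y X U := by
  obtain ⟨L, hL, hKL, hLΩ⟩ := exists_compact_between hK hΩ hKΩ
  obtain ⟨f, hf1, hf0, -⟩ := exists_contMDiffMap_one_nhds_of_subset_interior (n := 1)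
    (modelWithCornersSelf ℝ E) hK.isClosed hKL
  have hfs : ContDiff ℝ 1 f := f.contMDiff.contDiff
  obtain ⟨W, hKW, hW, hW1⟩ := (eventually_nhdsSet_iff_exists.1 hf1)
  refine ⟨fun x => f x • X x, ?_, ?_, W ∩ interior L, ?_, ?_, ?_, ?_⟩
  · rw [contDiff_iff_contDiffAt]
    intro x
    by_cases hx : x ∈ Ω
    · exact hfs.contDiffAt.smul (hX.contDiffAt (hΩ.mem_nhds hx))
    · have : ∀ᶠ y in 𝓝 x, (fun y => f y • X y) y = 0 := by
        filter_upwards [hL.isClosed.isOpen_compl.mem_nhds (fun h => hx (hLΩ h))] with y hy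
        simp [hf0 y hy]
      exact (contDiffAt_const (c := (0 : E))).congr_of_eventuallyEq this
  · exact HasCompactSupport.intro hL (fun x hx => by simp [hf0 x hx])
  · exact hKW.inter isOpen_interior
  · exact subset_inter hW hKL
  · exact fun x hx => hLΩ (interior_subset hx.2)
  · intro x hx
    simp [hW1 x hx.1]

theorem IsSol.unique {X : E → E} {Ω : Set E} (hΩ : IsOpen Ω) (hX : ContDiffOn ℝ 1 X Ω)
    {T : ℝ} {γ η : ℝ → E} (hγ : IsSol X Ω T γ) (hη : IsSol X Ω T η) (h0 : γ 0 = η 0) :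
    EqOn γ η (Icc 0 T) := by
  have hK : IsCompact (γ '' Icc 0 T ∪ η '' Icc 0 T) :=
    (isCompact_Icc.image_of_continuousOn hγ.continuousOn).union
      (isCompact_Icc.image_of_continuousOn hη.continuousOn)
  obtain ⟨Y, hY, hYc, U, -, hKU, -, hYX⟩ := exists_cutoff hΩ hX hK (by
    rintro x (⟨t, ht, rfl⟩ | ⟨t, ht, rfl⟩)
    exacts [(hγ t ht).1, (hη t ht).1])
  obtain ⟨C, hC⟩ := hY.lipschitzWith_of_hasCompactSupport hYc one_ne_zero
  refine ODE_solution_unique (v := fun _ => Y) (fun _ => hC) hγ.continuousOn (fun t ht => ?_)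
    hη.continuousOn (fun t ht => ?_) h0
  · rw [hYX (hKU (Or.inl ⟨t, Ico_subset_Icc_self ht, rfl⟩))]
    exact (hγ t (Ico_subset_Icc_self ht)).2.hasDerivWithinAt
  · rw [hYX (hKU (Or.inr ⟨t, Ico_subset_Icc_self ht, rfl⟩))]
    exact (hη t (Ico_subset_Icc_self ht)).2.hasDerivWithinAt

/-- Solutions persist on compact time intervals under perturbation of the initial value. -/
theorem IsSol.exists_near {X : E → E} {Ω : Set E} (hΩ : IsOpen Ω) (hX : ContDiffOn ℝ 1 X Ω)
    {T : ℝ} (hT : 0 ≤ T) {γ : ℝ → E} (hγ : IsSol X Ω T γ) {ε : ℝ} (hε : 0 < ε) :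
    ∃ δ > 0, ∀ y, dist y (γ 0) < δ →
      ∃ η, IsSol X Ω T η ∧ η 0 = y ∧ ∀ t ∈ Icc 0 T, dist (η t) (γ t) < ε := by
  have hK : IsCompact (γ '' Icc 0 T) := isCompact_Icc.image_of_continuousOn hγ.continuousOn
  obtain ⟨Y, hY, hYc, U, hU, hKU, hUΩ, hYX⟩ := exists_cutoff hΩ hX hK (by
    rintro x ⟨t, ht, rfl⟩
    exact (hγ t ht).1)
  obtain ⟨C, hC⟩ := hY.lipschitzWith_of_hasCompactSupport hYc one_ne_zero
  obtain ⟨M, hM⟩ := hYc.exists_bound_of_continuous hY.continuous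
  obtain ⟨ρ, hρ, hρU⟩ := hK.exists_thickening_subset_open hU hKU
  set e := Real.exp (C * T) with he
  have hepos : 0 < e := Real.exp_pos _
  refine ⟨min ε ρ / (2 * e), by positivity, fun y hy => ?_⟩
  let L : NNReal := ⟨max M 0, le_max_right _ _⟩
  have hT1 : (0 : ℝ) ≤ T + 1 := by linarith
  have hmem : (0 : ℝ) ∈ Icc (-1) (T + 1) := ⟨by norm_num, hT1⟩
  let B : NNReal := ⟨T + 1, hT1⟩
  have hpl : IsPicardLindelof (fun _ : ℝ => Y) (tmin := -1) (tmax := T + 1)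
      ⟨0, hmem⟩ y (L * B) 0 L C := by
    refine IsPicardLindelof.of_time_independent (fun x _ => ?_) hC.lipschitzOnWith ?_
    · exact (hM x).trans (le_max_left _ _)
    · have : max (T + 1 - 0) (0 - -1) = T + 1 := by
        rw [max_eq_left] <;> linarith
      simp only [this]
      rw [NNReal.coe_zero, sub_zero, NNReal.coe_mul]
      exact le_rfl
  obtain ⟨η, hη0, hη⟩ := hpl.exists_eq_forall_mem_Icc_hasDerivWithinAt₀
  have hηd : ∀ t ∈ Icc 0 T, HasDerivAt η (Y (η t)) t := fun t ht =>
    (hη t ⟨by linarith [ht.1], by linarith [ht.2]⟩).hasDerivAt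
      (Icc_mem_nhds (by linarith [ht.1]) (by linarith [ht.2]))
  have hdist : ∀ t ∈ Icc 0 T, dist (η t) (γ t) < min ε ρ := by
    intro t ht
    have hη0' : η 0 = y := hη0
    have := dist_le_of_trajectories_ODE (v := fun _ => Y) (a := 0) (b := T) (f := η) (g := γ)
      (δ := min ε ρ / (2 * e))
      (fun _ => hC)
      (fun t ht => (hηd t ht).continuousAt.continuousWithinAt)
      (fun t ht => (hηd t (Ico_subset_Icc_self ht)).hasDerivWithinAt) hγ.continuousOn
      (fun t ht => by
        rw [hYX (hKU ⟨t, Ico_subset_Icc_self ht, rfl⟩)]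
        exact (hγ t (Ico_subset_Icc_self ht)).2.hasDerivWithinAt)
      (by rw [hη0']; exact hy.le) t ht
    refine this.trans_lt ?_
    have h1 : Real.exp (C * (t - 0)) ≤ e := by
      rw [he, sub_zero]
      exact Real.exp_le_exp.2 (mul_le_mul_of_nonneg_left ht.2 C.2)
    have h2 : 0 < min ε ρ := lt_min hε hρ
    calc min ε ρ / (2 * e) * Real.exp (C * (t - 0)) ≤ min ε ρ / (2 * e) * e := by gcongr
      _ = min ε ρ / 2 := by field_simp
      _ < min ε ρ := by linarith
  have hηU : ∀ t ∈ Icc 0 T, η t ∈ U := fun t ht => hρU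
    (Metric.mem_thickening_iff.2 ⟨γ t, ⟨t, ht, rfl⟩, (hdist t ht).trans_le (min_le_right _ _)⟩)
  refine ⟨η, fun t ht => ⟨hUΩ (hηU t ht), ?_⟩, hη0, fun t ht =>
    (hdist t ht).trans_le (min_le_left _ _)⟩
  rw [← hYX (hηU t ht)]
  exact hηd t ht

/-- An integral curve on `[0, T)` with a limit in the domain at `T` extends beyond `T`. -/
theorem exists_extension {X : E → E} {Ω : Set E} (hΩ : IsOpen Ω) (hX : ContDiffOn ℝ 1 X Ω)
    {T : ℝ} (hT : 0 < T) {γ : ℝ → E} {p : E}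
    (hγ : ∀ t ∈ Ico 0 T, γ t ∈ Ω ∧ HasDerivAt γ (X (γ t)) t)
    (hp : p ∈ Ω) (hlim : Tendsto γ (𝓝[<] T) (𝓝 p)) :
    ∃ δ > 0, ∃ η, IsSol X Ω (T + δ) η ∧ ∀ t < T, η t = γ t := by
  obtain ⟨α, hα0, ε, hε, hα⟩ :=
    ContDiffAt.exists_forall_mem_closedBall_exists_eq_forall_mem_Ioo_hasDerivAt₀
      (hX.contDiffAt (hΩ.mem_nhds hp)) T
  have hαc : ContinuousAt α T := (hα T ⟨by linarith, by linarith⟩).continuousAt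
  have hαΩ : ∀ᶠ t in 𝓝 T, α t ∈ Ω := hαc.eventually (by rw [hα0]; exact hΩ.mem_nhds hp)
  obtain ⟨d, hd, hdΩ⟩ := Metric.eventually_nhds_iff.1 hαΩ
  let η : ℝ → E := fun t => if t < T then γ t else α t
  have hηlt : ∀ t < T, η t = γ t := fun t ht => if_pos ht
  have hηge : ∀ t, T ≤ t → η t = α t := fun t ht => if_neg (not_lt.2 ht)
  have hηT : η T = p := by rw [hηge T le_rfl, hα0]
  refine ⟨min (ε / 2) (d / 2), by positivity, η, fun t ht => ?_, hηlt⟩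
  have hm1 := min_le_left (ε / 2) (d / 2)
  have hm2 := min_le_right (ε / 2) (d / 2)
  rcases lt_trichotomy t T with h | h | h
  · rw [hηlt t h]
    refine ⟨(hγ t ⟨ht.1, h⟩).1, (hγ t ⟨ht.1, h⟩).2.congr_of_eventuallyEq ?_⟩
    filter_upwards [Iio_mem_nhds h] with u hu using hηlt u hu
  · subst h
    rw [hηT]
    refine ⟨hp, ?_⟩
    have hright : HasDerivWithinAt η (X p) (Ici t) t := by
      have := (hα t ⟨by linarith, by linarith⟩).hasDerivWithinAt (s := Ici t)
      rw [hα0] at this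
      exact this.congr (fun u hu => hηge u hu) (hηge t le_rfl)
    have hlim' : Tendsto η (𝓝[<] t) (𝓝 p) :=
      hlim.congr' (by filter_upwards [self_mem_nhdsWithin] with u hu using (hηlt u hu).symm)
    have hdiff : ∀ u ∈ Ioo 0 t, HasDerivAt η (X (γ u)) u := fun u hu =>
      (hγ u ⟨hu.1.le, hu.2⟩).2.congr_of_eventuallyEq
        (by filter_upwards [Iio_mem_nhds hu.2] with w hw using hηlt w hw)
    have hleft : HasDerivWithinAt η (X p) (Iic t) t := by
      refine hasDerivWithinAt_Iic_of_tendsto_deriv (s := Ioo 0 t)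
        (fun u hu => (hdiff u hu).differentiableAt.differentiableWithinAt) ?_
        (Ioo_mem_nhdsLT hT) ?_
      · rw [ContinuousWithinAt, hηT]
        exact hlim'.mono_left (nhdsWithin_mono _ Ioo_subset_Iio_self)
      · have : Tendsto (fun u => X (γ u)) (𝓝[<] t) (𝓝 (X p)) :=
          ((hX.continuousOn.continuousAt (hΩ.mem_nhds hp)).tendsto).comp hlim
        refine this.congr' ?_
        filter_upwards [Ioo_mem_nhdsLT hT] with u hu using (hdiff u hu).deriv.symm
    have := hleft.union hright
    rwa [Iic_union_Ici, hasDerivWithinAt_univ] at this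
  · rw [hηge t h.le]
    have hdt : dist t T < d := by
      rw [Real.dist_eq, abs_of_pos (by linarith)]
      linarith [ht.2]
    refine ⟨hdΩ hdt, (hα t ⟨by linarith, by linarith [ht.2]⟩).congr_of_eventuallyEq ?_⟩
    filter_upwards [Ioi_mem_nhds h] with u hu using hηge u (le_of_lt hu)

theorem exists_isSol {X : E → E} {Ω : Set E} (hΩ : IsOpen Ω) (hX : ContDiffOn ℝ 1 X Ω)
    {p : E} (hp : p ∈ Ω) : ∃ δ > 0, ∃ γ, IsSol X Ω δ γ ∧ γ 0 = p := by
  obtain ⟨α, hα0, ε, hε, hα⟩ :=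
    ContDiffAt.exists_forall_mem_closedBall_exists_eq_forall_mem_Ioo_hasDerivAt₀
      (hX.contDiffAt (hΩ.mem_nhds hp)) 0
  have hαc : ContinuousAt α 0 := (hα 0 ⟨by linarith, by linarith⟩).continuousAt
  have hαΩ : ∀ᶠ t in 𝓝 0, α t ∈ Ω := hαc.eventually (by rw [hα0]; exact hΩ.mem_nhds hp)
  obtain ⟨d, hd, hdΩ⟩ := Metric.eventually_nhds_iff.1 hαΩ
  have hm1 := min_le_left (ε / 2) (d / 2)
  have hm2 := min_le_right (ε / 2) (d / 2)
  refine ⟨min (ε / 2) (d / 2), by positivity, α, fun t ht => ⟨hdΩ ?_, hα t ?_⟩, hα0⟩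
  · rw [Real.dist_eq, sub_zero, abs_of_nonneg ht.1]
    linarith [ht.2]
  · exact ⟨by linarith [ht.1], by linarith [ht.2]⟩

/-- Solutions with a common initial value on all shorter intervals glue together. -/
theorem exists_glue {X : E → E} {Ω : Set E} (hΩ : IsOpen Ω) (hX : ContDiffOn ℝ 1 X Ω)
    {p : E} {S : ℝ}
    (h : ∀ T ∈ Ioo 0 S, ∃ γ, IsSol X Ω T γ ∧ γ 0 = p) (hS : 0 < S) :
    ∃ Γ : ℝ → E, Γ 0 = p ∧ ∀ T ∈ Ico 0 S, IsSol X Ω T Γ := by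
  choose! γ hγ h0 using h
  let f : ℝ → ℝ := fun t => max (3 / 4 * S) ((t + S) / 2)
  have hf : ∀ t ∈ Ico 0 S, f t ∈ Ioo 0 S ∧ t < f t := fun t ht =>
    ⟨⟨(by positivity : 0 < 3 / 4 * S).trans_le (le_max_left _ _),
      max_lt (by linarith) (by linarith [ht.2])⟩, lt_max_of_lt_right (by linarith [ht.2])⟩
  have h0S : (0 : ℝ) ∈ Ico 0 S := ⟨le_rfl, hS⟩
  refine ⟨fun t => γ (f t) t, h0 _ (hf 0 h0S).1, fun T hT t ht => ?_⟩
  have htS : t ∈ Ico 0 S := ⟨ht.1, ht.2.trans_lt hT.2⟩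
  obtain ⟨hft, hlt⟩ := hf t htS
  have hsol := hγ _ hft t ⟨ht.1, hlt.le⟩
  refine ⟨hsol.1, hsol.2.congr_of_eventuallyEq ?_⟩
  rcases lt_or_ge t (S / 2) with hts | hts
  · have e : ∀ r < S / 2, f r = 3 / 4 * S := fun r hr => max_eq_left (by linarith)
    filter_upwards [Iio_mem_nhds hts] with r hr
    simp only [e r hr, e t hts]
  · filter_upwards [Ioo_mem_nhds (by linarith : (0 : ℝ) < t) hlt] with r hr
    have hrS : r ∈ Ico 0 S := ⟨hr.1.le, hr.2.trans hft.2⟩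
    obtain ⟨hfr, hrlt⟩ := hf r hrS
    exact ((hγ _ hfr).mono hrlt.le).unique hΩ hX ((hγ _ hft).mono hr.2.le)
      ((h0 _ hfr).trans (h0 _ hft).symm) ⟨hr.1.le, le_rfl⟩

end ODE

section Potential

open Topology

/-- The first partial derivative of the effective potential. -/
noncomputable def Vx (μ : ℝ) (q : ℝ × ℝ) : ℝ :=
  -(q.1 - μ) + μ * (q.1 - 1) / nrm (q.1 - 1, q.2) ^ 3 + (1 - μ) * q.1 / nrm q ^ 3

/-- The second partial derivative of the effective potential. -/
noncomputable def Vy (μ : ℝ) (q : ℝ × ℝ) : ℝ :=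
  q.2 * (-1 + μ / nrm (q.1 - 1, q.2) ^ 3 + (1 - μ) / nrm q ^ 3)

theorem nrm_nonneg (v : ℝ × ℝ) : 0 ≤ nrm v := Real.sqrt_nonneg _

theorem nrm_sq (v : ℝ × ℝ) : nrm v ^ 2 = v.1 ^ 2 + v.2 ^ 2 := Real.sq_sqrt (by positivity)

theorem nrm_pos {v : ℝ × ℝ} (hv : v ≠ (0, 0)) : 0 < nrm v := by
  refine Real.sqrt_pos.2 ?_
  by_contra h
  have h1 : v.1 = 0 := by nlinarith [sq_nonneg v.1, sq_nonneg v.2]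
  have h2 : v.2 = 0 := by nlinarith [sq_nonneg v.1, sq_nonneg v.2]
  exact hv (Prod.ext h1 h2)

theorem sub_ne_zero_of_ne_one {q : ℝ × ℝ} (hq : q ≠ (1, 0)) :
    (q.1 - 1, q.2) ≠ ((0, 0) : ℝ × ℝ) := by
  intro h
  rw [Prod.mk.injEq] at h
  exact hq (Prod.ext (by simpa using sub_eq_zero.1 h.1) h.2)

theorem abs_fst_le_nrm (v : ℝ × ℝ) : |v.1| ≤ nrm v :=
  abs_le_of_sq_le_sq (by rw [nrm_sq]; nlinarith [sq_nonneg v.2]) (nrm_nonneg v)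

theorem nrm_mk_zero (x : ℝ) : nrm (x, 0) = |x| := by
  simp [nrm, Real.sqrt_sq_eq_abs]

theorem hasFDerivAt_nrm {v : ℝ × ℝ} (hv : v ≠ (0, 0)) :
    HasFDerivAt nrm ((v.1 / nrm v) • ContinuousLinearMap.fst ℝ ℝ ℝ +
      (v.2 / nrm v) • ContinuousLinearMap.snd ℝ ℝ ℝ) v := by
  have h0 := nrm_pos hv
  have h1 : HasFDerivAt (fun v : ℝ × ℝ => v.1 ^ 2 + v.2 ^ 2) _ v :=
    ((hasFDerivAt_fst (𝕜 := ℝ) (p := v)).pow 2).add ((hasFDerivAt_snd (𝕜 := ℝ) (p := v)).pow 2)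
  have h2 := h1.sqrt (by rw [← nrm_sq]; positivity)
  refine h2.congr_fderiv ?_
  change (1 / (2 * nrm v)) • _ = _
  ext <;> simp <;> field_simp

theorem hasFDerivAt_V (μ : ℝ) {q : ℝ × ℝ} (h0 : q ≠ (0, 0)) (h1 : q ≠ (1, 0)) :
    HasFDerivAt (V μ) (Vx μ q • ContinuousLinearMap.fst ℝ ℝ ℝ +
      Vy μ q • ContinuousLinearMap.snd ℝ ℝ ℝ) q := by
  have hr := nrm_pos h0
  have hr1 := nrm_pos (sub_ne_zero_of_ne_one h1)
  have hf := hasFDerivAt_fst (𝕜 := ℝ) (p := q)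
  have hs := hasFDerivAt_snd (𝕜 := ℝ) (p := q)
  have hshift : HasFDerivAt (fun q : ℝ × ℝ => (q.1 - 1, q.2)) _ q := (hf.sub_const 1).prodMk hs
  have hn1 := HasFDerivAt.comp q (hasFDerivAt_nrm (sub_ne_zero_of_ne_one h1)) hshift
  have hA : HasFDerivAt (fun q : ℝ × ℝ => (q.1 - μ) ^ 2 + q.2 ^ 2) _ q :=
    ((hf.sub_const μ).pow 2).add (hs.pow 2)
  have hi1 := ((hasDerivAt_inv hr1.ne').comp_hasFDerivAt q hn1).const_mul μ
  have hi0 := ((hasDerivAt_inv hr.ne').comp_hasFDerivAt q (hasFDerivAt_nrm h0)).const_mul (1 - μ)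
  have hV := ((hA.const_mul (1 / 2)).neg.sub hi1).sub hi0
  have hVe : V μ = fun q : ℝ × ℝ => -(1 / 2 * ((q.1 - μ) ^ 2 + q.2 ^ 2))
      - μ * (nrm (q.1 - 1, q.2))⁻¹ - (1 - μ) * (nrm q)⁻¹ := by
    funext q
    simp only [V]
    ring
  rw [hVe]
  refine HasFDerivAt.congr_fderiv hV ?_
  ext
  · simp [Vx]
    field_simp
  · simp [Vy]
    field_simp

theorem contDiffAt_nrm {v : ℝ × ℝ} (hv : v ≠ (0, 0)) : ContDiffAt ℝ 1 nrm v := by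
  have : ContDiffAt ℝ 1 (fun v : ℝ × ℝ => v.1 ^ 2 + v.2 ^ 2) v :=
    ((contDiffAt_fst).pow 2).add ((contDiffAt_snd).pow 2)
  exact this.sqrt (by rw [← nrm_sq]; exact (pow_pos (nrm_pos hv) 2).ne')

/-- The PCR3BP vector field on position-velocity space. -/
noncomputable def field (μ : ℝ) (p : (ℝ × ℝ) × (ℝ × ℝ)) : (ℝ × ℝ) × (ℝ × ℝ) :=
  (p.2, (2 * p.2.2 - Vx μ p.1, -2 * p.2.1 - Vy μ p.1))

/-- The phase space away from the collisions. -/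
def dom : Set ((ℝ × ℝ) × (ℝ × ℝ)) := {p | p.1 ≠ (0, 0) ∧ p.1 ≠ (1, 0)}

theorem isOpen_dom : IsOpen dom :=
  (isOpen_ne.preimage continuous_fst).inter (isOpen_ne.preimage continuous_fst)

theorem contDiffOn_field (μ : ℝ) : ContDiffOn ℝ 1 (field μ) dom := by
  rintro p ⟨h0, h1⟩
  refine ContDiffAt.contDiffWithinAt ?_
  have hf : ContDiffAt ℝ 1 (fun p : (ℝ × ℝ) × (ℝ × ℝ) => p.1) p := contDiffAt_fst
  have h2 : ContDiffAt ℝ 1 (fun p : (ℝ × ℝ) × (ℝ × ℝ) => p.2) p := contDiffAt_snd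
  have hq1 : ContDiffAt ℝ 1 (fun p : (ℝ × ℝ) × (ℝ × ℝ) => p.1.1) p := hf.fst
  have hq2 : ContDiffAt ℝ 1 (fun p : (ℝ × ℝ) × (ℝ × ℝ) => p.1.2) p := hf.snd
  have hn : ContDiffAt ℝ 1 (fun p : (ℝ × ℝ) × (ℝ × ℝ) => nrm p.1) p :=
    ContDiffAt.comp (g := nrm) p (contDiffAt_nrm h0) hf
  have hn1 : ContDiffAt ℝ 1 (fun p : (ℝ × ℝ) × (ℝ × ℝ) => nrm (p.1.1 - 1, p.1.2)) p :=
    ContDiffAt.comp (g := nrm) (f := fun p : (ℝ × ℝ) × (ℝ × ℝ) => (p.1.1 - 1, p.1.2)) p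
      (contDiffAt_nrm (sub_ne_zero_of_ne_one h1))
      ((hq1.sub contDiffAt_const).prodMk hq2)
  have e0 : nrm p.1 ^ 3 ≠ 0 := (pow_pos (nrm_pos h0) 3).ne'
  have e1 : nrm (p.1.1 - 1, p.1.2) ^ 3 ≠ 0 := (pow_pos (nrm_pos (sub_ne_zero_of_ne_one h1)) 3).ne'
  have hVx : ContDiffAt ℝ 1 (fun p : (ℝ × ℝ) × (ℝ × ℝ) => Vx μ p.1) p :=
    (((hq1.sub contDiffAt_const).neg.add ((contDiffAt_const.mul (hq1.sub contDiffAt_const)).div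
      (hn1.pow 3) e1)).add ((contDiffAt_const.mul hq1).div (hn.pow 3) e0))
  have hVy : ContDiffAt ℝ 1 (fun p : (ℝ × ℝ) × (ℝ × ℝ) => Vy μ p.1) p :=
    hq2.mul ((contDiffAt_const.add (contDiffAt_const.div (hn1.pow 3) e1)).add
      (contDiffAt_const.div (hn.pow 3) e0))
  exact h2.prodMk (((contDiffAt_const.mul h2.snd).sub hVx).prodMk
    ((contDiffAt_const.mul h2.fst).sub hVy))

theorem mem_critSet {μ : ℝ} {q : ℝ × ℝ} (h0 : q ≠ (0, 0)) (h1 : q ≠ (1, 0)) :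
    q ∈ critSet μ ↔ Vx μ q = 0 ∧ Vy μ q = 0 := by
  have hd := (hasFDerivAt_V μ h0 h1).fderiv
  constructor
  · rintro ⟨-, -, h⟩
    rw [hd] at h
    have hx := congrArg (fun L : ℝ × ℝ →L[ℝ] ℝ => L (1, 0)) h
    have hy := congrArg (fun L : ℝ × ℝ →L[ℝ] ℝ => L (0, 1)) h
    simp at hx hy
    exact ⟨hx, hy⟩
  · rintro ⟨hx, hy⟩
    refine ⟨h0, h1, ?_⟩
    rw [hd, hx, hy]
    simp

/-- Off the line of the primaries, a critical point has unit distance to both of them. -/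
theorem dist_eq_one_of_critical {μ : ℝ} (hμ : μ ∈ Ioo (0 : ℝ) 1) {q : ℝ × ℝ}
    (h0 : q ≠ (0, 0)) (h1 : q ≠ (1, 0))
    (hx : Vx μ q = 0) (hy : Vy μ q = 0) (hq : q.2 ≠ 0) :
    nrm q = 1 ∧ nrm (q.1 - 1, q.2) = 1 := by
  have hr := nrm_pos h0
  have hr1 := nrm_pos (sub_ne_zero_of_ne_one h1)
  simp only [Vx, Vy] at hx hy
  set r := nrm q
  set ρ := nrm (q.1 - 1, q.2)
  have hF := (mul_eq_zero.1 hy).resolve_left hq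
  have e1 : μ * (1 - 1 / ρ ^ 3) = 0 := by
    have : -(q.1 - μ) + μ * (q.1 - 1) / ρ ^ 3 + (1 - μ) * q.1 / r ^ 3 =
      q.1 * (-1 + μ / ρ ^ 3 + (1 - μ) / r ^ 3) + μ * (1 - 1 / ρ ^ 3) := by ring
    rw [hF] at this
    linarith
  have e2 : 1 / ρ ^ 3 = 1 := by
    have := (mul_eq_zero.1 e1).resolve_left hμ.1.ne'
    linarith
  have e3 : 1 / r ^ 3 = 1 := by
    have h : (1 - μ) * (1 / r ^ 3 - 1) = 0 := by
      have : -1 + μ / ρ ^ 3 + (1 - μ) / r ^ 3 = -1 + μ * (1 / ρ ^ 3) + (1 - μ) * (1 / r ^ 3) := by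
        ring
      rw [this, e2] at hF
      linarith
    have := (mul_eq_zero.1 h).resolve_left (by linarith [hμ.2])
    linarith
  rw [one_div, inv_eq_one] at e2 e3
  exact ⟨(pow_eq_one_iff_of_nonneg hr.le three_ne_zero).1 e3,
    (pow_eq_one_iff_of_nonneg hr1.le three_ne_zero).1 e2⟩

theorem inv_bound_of_sq {a t C : ℝ} (ha : 0 < a) (h : a / t ^ 2 ≤ C) :
    a / t ≤ C + a := by
  have h1 : 1 / t ≤ 1 / t ^ 2 + 1 := by
    have : 0 ≤ (1 / t - 1 / 2) ^ 2 := sq_nonneg _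
    have e : 1 / t ^ 2 = (1 / t) ^ 2 := by rw [div_pow, one_pow]
    rw [e]
    nlinarith
  calc a / t = a * (1 / t) := by ring
    _ ≤ a * (1 / t ^ 2 + 1) := by gcongr
    _ = a / t ^ 2 + a := by ring
    _ ≤ C + a := by linarith

theorem bddBelow_critical_values {μ : ℝ} (hμ : μ ∈ Ioo (0 : ℝ) 1) :
    BddBelow (V μ '' critSet μ) := by
  refine ⟨-100, ?_⟩
  rintro _ ⟨q, hq, rfl⟩
  have h0 := hq.1
  have h1 := hq.2.1
  obtain ⟨hx, hy⟩ := (mem_critSet h0 h1).1 hq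
  have hm0 := hμ.1
  have hm1 := hμ.2
  by_cases hq2 : q.2 = 0
  · obtain ⟨x, y⟩ := q
    simp only at hq2
    subst hq2
    have hx0 : x ≠ 0 := fun h => h0 (by rw [h])
    have hx1 : x - 1 ≠ 0 := fun h => h1 (by rw [sub_eq_zero.1 h])
    have a0 : 0 < |x| := abs_pos.2 hx0
    have a1 : 0 < |x - 1| := abs_pos.2 hx1
    simp only [Vx, V, nrm_mk_zero] at hx ⊢
    have b0 : |(1 - μ) * x / |x| ^ 3| = (1 - μ) / |x| ^ 2 := by
      rw [abs_div, abs_mul, abs_of_pos (by linarith : 0 < 1 - μ), abs_pow, abs_abs]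
      field_simp
    have b1 : |μ * (x - 1) / |x - 1| ^ 3| = μ / |x - 1| ^ 2 := by
      rw [abs_div, abs_mul, abs_of_pos hm0, abs_pow, abs_abs]
      field_simp
    have hle : ∀ {a t d : ℝ}, 0 < a → a < 1 → 0 < d → d ≤ t → a / t ^ 2 ≤ 1 / d ^ 2 :=
      fun ha ha1 hd hdt => by gcongr
    have hx3 : |x| ≤ 3 := by
      by_contra! h
      have c0 : (1 - μ) / |x| ^ 2 ≤ 1 / 3 ^ 2 :=
        hle (by linarith) (by linarith) (by norm_num) h.le
      have c1 : μ / |x - 1| ^ 2 ≤ 1 / 2 ^ 2 := by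
        refine hle hm0 hm1 (by norm_num) ?_
        have := abs_sub_abs_le_abs_sub x 1
        rw [abs_one] at this
        linarith
      rw [← b0] at c0
      rw [← b1] at c1
      have d0 := abs_le.1 c0
      have d1 := abs_le.1 c1
      rcases abs_cases x with ⟨e, -⟩ | ⟨e, -⟩ <;> rw [e] at h <;> linarith [d0.1, d0.2, d1.1, d1.2]
    have hx3' := abs_le.1 hx3
    have key : (1 - μ) / |x| ^ 2 ≤ 9 ∧ μ / |x - 1| ^ 2 ≤ 9 := by
      rcases le_total (1 / 2) |x| with h | h
      · have c0 : (1 - μ) / |x| ^ 2 ≤ 1 / (1 / 2) ^ 2 :=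
          hle (by linarith) (by linarith) (by norm_num) h
        refine ⟨by linarith, ?_⟩
        rw [← b0] at c0
        rw [← b1]
        have d0 := abs_le.1 c0
        exact abs_le.2 ⟨by linarith [d0.1, d0.2], by linarith [d0.1, d0.2]⟩
      · have h' := abs_le.1 h
        have c1 : μ / |x - 1| ^ 2 ≤ 1 / (1 / 2) ^ 2 := by
          refine hle hm0 hm1 (by norm_num) ?_
          rw [abs_sub_comm]
          exact le_abs.2 (Or.inl (by linarith))
        refine ⟨?_, by linarith⟩
        rw [← b1] at c1
        rw [← b0]
        have d1 := abs_le.1 c1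
        exact abs_le.2 ⟨by linarith [d1.1, d1.2], by linarith [d1.1, d1.2]⟩
    have f0 := inv_bound_of_sq (by linarith) key.1
    have f1 := inv_bound_of_sq hm0 key.2
    have : (x - μ) ^ 2 ≤ 16 := by nlinarith
    linarith
  · obtain ⟨e0, e1⟩ := dist_eq_one_of_critical hμ h0 h1 hx hy hq2
    have s0 := nrm_sq q
    simp only [V, e0, e1] at s0 ⊢
    nlinarith [sq_nonneg (q.1 + μ)]

theorem Vx_axis {μ x : ℝ} (hx : x ∈ Ioo (0 : ℝ) 1) :
    Vx μ (x, 0) = -(x - μ) - μ / (1 - x) ^ 2 + (1 - μ) / x ^ 2 := by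
  have h0 := hx.1
  have h1 : 0 < 1 - x := sub_pos.2 hx.2
  simp only [Vx, nrm_mk_zero, abs_of_pos h0, abs_of_neg (by linarith : x - 1 < 0)]
  have e : -(x - 1) = 1 - x := by ring
  rw [e]
  have e2 : x - 1 = -(1 - x) := by ring
  rw [e2]
  field_simp
  ring

theorem V_axis {μ x : ℝ} (hx : x ∈ Ioo (0 : ℝ) 1) :
    V μ (x, 0) = -((x - μ) ^ 2 / 2) - μ / (1 - x) - (1 - μ) / x := by
  simp only [V, nrm_mk_zero, abs_of_pos hx.1, abs_of_neg (by linarith [hx.2] : x - 1 < 0)]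
  ring

/-- The collinear Lagrange point between the primaries. -/
theorem exists_lagrange_point {μ : ℝ} (hμ : μ ∈ Ioo (0 : ℝ) 1) :
    ∃ l ∈ Ioo (0 : ℝ) 1, Vx μ (l, 0) = 0 := by
  let N : ℝ → ℝ := fun x => (1 - μ) * (1 - x) ^ 2 - μ * x ^ 2 - (x - μ) * x ^ 2 * (1 - x) ^ 2
  have hN : Continuous N := by fun_prop
  obtain ⟨l, hl, hl0⟩ := intermediate_value_Ioo' (zero_le_one' ℝ) hN.continuousOn
    (show (0 : ℝ) ∈ Ioo (N 1) (N 0) by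
      constructor <;> simp [N] <;> linarith [hμ.1, hμ.2])
  refine ⟨l, hl, ?_⟩
  rw [Vx_axis hl]
  have h0 := hl.1
  have h1 : 0 < 1 - l := sub_pos.2 hl.2
  have : -(l - μ) - μ / (1 - l) ^ 2 + (1 - μ) / l ^ 2 = N l / (l ^ 2 * (1 - l) ^ 2) := by
    simp only [N]
    field_simp
    ring
  rw [this, hl0, zero_div]

theorem firstCriticalValue_le {μ l : ℝ} (hμ : μ ∈ Ioo (0 : ℝ) 1) (hl : l ∈ Ioo (0 : ℝ) 1)
    (h : Vx μ (l, 0) = 0) : firstCriticalValue μ ≤ V μ (l, 0) := by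
  refine csInf_le (bddBelow_critical_values hμ) ⟨(l, 0), ?_, rfl⟩
  refine (mem_critSet (fun e => hl.1.ne' (Prod.mk.inj e).1)
    (fun e => hl.2.ne (Prod.mk.inj e).1)).2 ⟨h, ?_⟩
  simp [Vy]

/-- On a circle about `O` of radius less than one, the potential is minimal towards `E`. -/
theorem V_le_of_circle {μ l : ℝ} (hμ : μ ∈ Ioo (0 : ℝ) 1) (hl : l ∈ Ioo (0 : ℝ) 1) {q : ℝ × ℝ}
    (hq : nrm q = l) : V μ (l, 0) ≤ V μ q := by
  have h0 := hl.1
  have h1 : 0 < 1 - l := sub_pos.2 hl.2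
  rw [V_axis hl]
  simp only [V, hq]
  have s0 := nrm_sq q
  have s1 := nrm_sq (q.1 - 1, q.2)
  have hxl := abs_le.1 (abs_fst_le_nrm q)
  set ρ := nrm (q.1 - 1, q.2) with hρ
  rw [hq] at s0 hxl
  simp only at s1
  have b0 : 1 - l ≤ ρ := by
    refine le_of_sq_le_sq ?_ (nrm_nonneg _)
    nlinarith
  have b1 : ρ ≤ 1 + l := by
    refine le_of_sq_le_sq ?_ (by linarith)
    nlinarith
  have hρ0 : 0 < ρ := h1.trans_le b0
  have c1 : (ρ - (1 - l)) / (ρ * (1 - l)) = 1 / (1 - l) - 1 / ρ := by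
    field_simp
  have c2 : (ρ - (1 - l)) * ((ρ + (1 - l)) / 2) ≤ (ρ - (1 - l)) / (ρ * (1 - l)) := by
    rw [div_eq_mul_one_div (ρ - (1 - l))]
    refine mul_le_mul_of_nonneg_left ?_ (by linarith)
    have p1 : ρ * (1 - l) ≤ 1 := by nlinarith
    have p2 : 1 ≤ 1 / (ρ * (1 - l)) := by
      rw [le_div_iff₀ (by positivity)]
      linarith
    linarith
  rw [c1] at c2
  have c3 : 0 ≤ μ * (1 / (1 - l) - 1 / ρ - (ρ - (1 - l)) * ((ρ + (1 - l)) / 2)) :=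
    mul_nonneg hμ.1.le (by linarith)
  have c4 : (ρ - (1 - l)) * ((ρ + (1 - l)) / 2) = l - q.1 := by
    nlinarith
  rw [c4] at c3
  have d1 : μ / (1 - l) = μ * (1 / (1 - l)) := by ring
  have d2 : μ / ρ = μ * (1 / ρ) := by ring
  rw [d1, d2]
  nlinarith

theorem lagrange_identity {μ l : ℝ} (hl : l ∈ Ioo (0 : ℝ) 1) (h : Vx μ (l, 0) = 0) :
    (1 - μ) / l ^ 3 - 1 = μ * ((2 - l) / (1 - l) ^ 2) := by
  rw [Vx_axis hl] at h
  have h0 := hl.1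
  have h1 : 0 < 1 - l := sub_pos.2 hl.2
  field_simp at h ⊢
  nlinarith

theorem lagrange_bound {μ l r : ℝ} (hμ : μ ∈ Ioo (0 : ℝ) 1) (hl : l ∈ Ioo (0 : ℝ) 1)
    (h : Vx μ (l, 0) = 0) (hr : 0 < r) (hrl : r ≤ l) :
    μ * ((2 - l) / (1 - l) ^ 2) ≤ (1 - μ) / r ^ 3 - 1 := by
  rw [← lagrange_identity hl h]
  have : (1 - μ) / l ^ 3 ≤ (1 - μ) / r ^ 3 := by
    have := hμ.2
    have : 0 ≤ 1 - μ := by linarith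
    gcongr
  linarith

theorem Vy_nonpos {μ l : ℝ} (hμ : μ ∈ Ioo (0 : ℝ) 1) (hl : l ∈ Ioo (0 : ℝ) 1)
    (h : Vx μ (l, 0) = 0) {q : ℝ × ℝ} (h0 : q ≠ (0, 0)) (hq : nrm q ≤ l) (hq2 : q.2 ≤ 0) :
    Vy μ q ≤ 0 := by
  have hb := lagrange_bound hμ hl h (nrm_pos h0) hq
  have h1 : 0 < 1 - l := sub_pos.2 hl.2
  have h2 : 0 < 2 - l := by linarith
  have hp : 0 < μ * ((2 - l) / (1 - l) ^ 2) := mul_pos hμ.1 (by positivity)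
  have hn : 0 ≤ μ / nrm (q.1 - 1, q.2) ^ 3 :=
    div_nonneg hμ.1.le (pow_nonneg (nrm_nonneg _) 3)
  exact mul_nonpos_of_nonpos_of_nonneg hq2 (by linarith)

theorem Vx_lower {μ l : ℝ} (hμ : μ ∈ Ioo (0 : ℝ) 1) (hl : l ∈ Ioo (0 : ℝ) 1)
    (h : Vx μ (l, 0) = 0) {q : ℝ × ℝ} (h0 : q ≠ (0, 0)) (hq : nrm q ≤ l) (hq1 : 0 ≤ q.1)
    (hl1 : q.1 < 1) :
    μ * (q.1 * ((2 - l) / (1 - l) ^ 2 - (2 - q.1) / (1 - q.1) ^ 2)) ≤ Vx μ q := by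
  have hb := lagrange_bound hμ hl h (nrm_pos h0) hq
  have hx1 : 0 < 1 - q.1 := sub_pos.2 hl1
  have hρ : 1 - q.1 ≤ nrm (q.1 - 1, q.2) := by
    have := abs_fst_le_nrm (q.1 - 1, q.2)
    simp only at this
    rw [abs_sub_comm, abs_of_pos hx1] at this
    exact this
  simp only [Vx]
  set r := nrm q
  set ρ := nrm (q.1 - 1, q.2)
  have e1 : (1 - q.1) / ρ ^ 3 ≤ 1 / (1 - q.1) ^ 2 := by
    calc (1 - q.1) / ρ ^ 3 ≤ (1 - q.1) / (1 - q.1) ^ 3 := by gcongr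
      _ = 1 / (1 - q.1) ^ 2 := by field_simp
  have e2 : 1 - 1 / (1 - q.1) ^ 2 = -(q.1 * ((2 - q.1) / (1 - q.1) ^ 2)) := by
    field_simp
    ring
  have e3 : -(q.1 - μ) + μ * (q.1 - 1) / ρ ^ 3 + (1 - μ) * q.1 / r ^ 3 =
      q.1 * ((1 - μ) / r ^ 3 - 1) + μ * (1 - (1 - q.1) / ρ ^ 3) := by ring
  rw [e3]
  have e4 := mul_le_mul_of_nonneg_left hb hq1
  have e5 : μ * (1 - 1 / (1 - q.1) ^ 2) ≤ μ * (1 - (1 - q.1) / ρ ^ 3) :=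
    mul_le_mul_of_nonneg_left (by linarith) hμ.1.le
  rw [e2] at e5
  linarith

theorem ratio_lt {x l : ℝ} (hx : x < l) (hl : l < 1) :
    (2 - x) / (1 - x) ^ 2 < (2 - l) / (1 - l) ^ 2 := by
  have h1 : 0 < 1 - l := by linarith
  have h2 : 0 < 1 - x := by linarith
  have e : ∀ t : ℝ, 0 < 1 - t → (2 - t) / (1 - t) ^ 2 = 1 / (1 - t) ^ 2 + 1 / (1 - t) := by
    intro t ht
    field_simp
    ring
  rw [e x h2, e l h1]
  have a1 : 1 / (1 - x) < 1 / (1 - l) := by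
    apply one_div_lt_one_div_of_lt h1; linarith
  have a2 : 1 / (1 - x) ^ 2 < 1 / (1 - l) ^ 2 := by
    apply one_div_lt_one_div_of_lt (by positivity)
    nlinarith
  linarith

theorem Vx_pos {μ l : ℝ} (hμ : μ ∈ Ioo (0 : ℝ) 1) (hl : l ∈ Ioo (0 : ℝ) 1)
    (h : Vx μ (l, 0) = 0) {q : ℝ × ℝ} (h0 : q ≠ (0, 0)) (hq : nrm q < l) (hq1 : 0 ≤ q.1) :
    0 < Vx μ q := by
  have hxl : q.1 < l := (le_abs_self _).trans_lt ((abs_fst_le_nrm q).trans_lt hq)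
  rcases hq1.eq_or_lt with hx | hx
  · have hy : q.2 ≠ 0 := fun e => h0 (Prod.ext hx.symm e)
    simp only [Vx, ← hx]
    have s1 := nrm_sq (q.1 - 1, q.2)
    rw [← hx] at s1
    have hy2 : 0 < q.2 ^ 2 := by positivity
    simp only at s1
    set ρ := nrm (0 - 1, q.2)
    have hρ : 1 < ρ := by
      by_contra! hc
      have : 0 ≤ ρ := nrm_nonneg _
      nlinarith
    have hρ3 : 1 < ρ ^ 3 := one_lt_pow₀ hρ three_ne_zero
    have : 1 / ρ ^ 3 < 1 := by rw [div_lt_one (by linarith)]; exact hρ3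
    have e : -(0 - μ) + μ * (0 - 1) / ρ ^ 3 + (1 - μ) * 0 / nrm q ^ 3 = μ * (1 - 1 / ρ ^ 3) := by
      ring
    rw [e]
    exact mul_pos hμ.1 (by linarith)
  · refine lt_of_lt_of_le ?_ (Vx_lower hμ hl h h0 hq.le hq1 (hxl.trans hl.2))
    have := ratio_lt hxl hl.2
    exact mul_pos hμ.1 (mul_pos hx (by linarith))

/-- The torque of the effective potential about `O`. -/
theorem torque_eq (μ : ℝ) (q : ℝ × ℝ) :
    q.1 * Vy μ q - q.2 * Vx μ q = -(μ * q.2 * (1 - 1 / nrm (q.1 - 1, q.2) ^ 3)) := by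
  simp only [Vx, Vy]
  ring

end Potential

section Trajectory

open Topology

theorem monotoneOn_of_hasDerivAt {f f' : ℝ → ℝ} {a b : ℝ}
    (hf : ∀ t ∈ Icc a b, HasDerivAt f (f' t) t) (h : ∀ t ∈ Icc a b, 0 ≤ f' t) :
    MonotoneOn f (Icc a b) :=
  monotoneOn_of_hasDerivWithinAt_nonneg (convex_Icc a b)
    (fun t ht => (hf t ht).continuousAt.continuousWithinAt)
    (fun t ht => (hf t (interior_subset ht)).hasDerivWithinAt) fun t ht => h t (interior_subset ht)

theorem antitoneOn_of_hasDerivAt {f f' : ℝ → ℝ} {a b : ℝ}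
    (hf : ∀ t ∈ Icc a b, HasDerivAt f (f' t) t) (h : ∀ t ∈ Icc a b, f' t ≤ 0) :
    AntitoneOn f (Icc a b) :=
  antitoneOn_of_hasDerivWithinAt_nonpos (convex_Icc a b)
    (fun t ht => (hf t ht).continuousAt.continuousWithinAt)
    (fun t ht => (hf t (interior_subset ht)).hasDerivWithinAt) fun t ht => h t (interior_subset ht)

theorem strictAntiOn_of_hasDerivAt {f f' : ℝ → ℝ} {a b : ℝ}
    (hf : ∀ t ∈ Icc a b, HasDerivAt f (f' t) t) (h : ∀ t ∈ Ioo a b, f' t < 0) :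
    StrictAntiOn f (Icc a b) :=
  strictAntiOn_of_deriv_neg (convex_Icc a b)
    (fun t ht => (hf t ht).continuousAt.continuousWithinAt) fun t ht => by
      rw [(hf t (interior_subset ht)).deriv]
      rw [interior_Icc] at ht
      exact h t ht

theorem exists_first_zero {f : ℝ → ℝ} {a b : ℝ} (hab : a ≤ b) (hf : ContinuousOn f (Icc a b))
    (ha : f a < 0) (hb : 0 ≤ f b) :
    ∃ t ∈ Ioc a b, f t = 0 ∧ ∀ r ∈ Ico a t, f r < 0 := by
  have hK : IsCompact (Icc a b ∩ f ⁻¹' Ici 0) :=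
    isCompact_Icc.of_isClosed_subset (hf.preimage_isClosed_of_isClosed isClosed_Icc isClosed_Ici)
      inter_subset_left
  obtain ⟨t, ⟨⟨hta, htb⟩, ht0⟩, hmin⟩ := hK.exists_isLeast ⟨b, ⟨hab, le_rfl⟩, hb⟩
  have hneg : ∀ r ∈ Ico a t, f r < 0 := fun r hr => by
    by_contra! h
    exact absurd (hmin ⟨⟨hr.1, hr.2.le.trans htb⟩, h⟩) (not_le.2 hr.2)
  have hat : a < t := lt_of_le_of_ne hta fun e => absurd ha (not_lt.2 (e ▸ ht0))
  refine ⟨t, ⟨hat, htb⟩, le_antisymm ?_ ht0, hneg⟩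
  have hc : Tendsto f (𝓝[Ico a t] t) (𝓝 (f t)) :=
    (hf t ⟨hta, htb⟩).mono_left (nhdsWithin_mono t fun r hr => ⟨hr.1, hr.2.le.trans htb⟩)
  have : (𝓝[Ico a t] t).NeBot := by
    rw [nhdsWithin_Ico_eq_nhdsLT hat]
    infer_instance
  exact le_of_tendsto hc (eventually_nhdsWithin_of_forall fun r hr => (hneg r hr).le)

/-- Energies `c` below the collinear critical value at `(l, 0)`, with `a` the first zero of
`V - c` on the segment from `O` to the critical point. -/
structure BelowCritical (μ c l a : ℝ) : Prop where
  hμ : μ ∈ Ioo (0 : ℝ) 1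
  hl : l ∈ Ioo (0 : ℝ) 1
  crit : Vx μ (l, 0) = 0
  lt_crit : c < V μ (l, 0)
  ha : a ∈ Ioo 0 l
  V_eq : V μ (a, 0) = c
  V_lt : ∀ x ∈ Ioo 0 a, V μ (x, 0) < c

theorem mk_ne_origin {x : ℝ} (hx : 0 < x) : ((x, 0) : ℝ × ℝ) ≠ (0, 0) :=
  fun e => hx.ne' (Prod.mk.inj e).1

theorem mk_ne_one {x : ℝ} (hx : x < 1) : ((x, 0) : ℝ × ℝ) ≠ (1, 0) :=
  fun e => hx.ne (Prod.mk.inj e).1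

theorem hasDerivAt_V_axis (μ : ℝ) {x : ℝ} (hx : x ∈ Ioo (0 : ℝ) 1) :
    HasDerivAt (fun x => V μ (x, 0)) (Vx μ (x, 0)) x := by
  have h := (hasFDerivAt_V μ (mk_ne_origin hx.1) (mk_ne_one hx.2)).comp_hasDerivAt x
    ((hasDerivAt_id x).prodMk (hasDerivAt_const x (0 : ℝ)))
  simpa [Function.comp_def] using h

theorem strictMonoOn_V_axis {μ l : ℝ} (hμ : μ ∈ Ioo (0 : ℝ) 1) (hl : l ∈ Ioo (0 : ℝ) 1)
    (h : Vx μ (l, 0) = 0) : StrictMonoOn (fun x => V μ (x, 0)) (Ioc 0 l) := by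
  refine strictMonoOn_of_deriv_pos (convex_Ioc 0 l) (fun x hx => ?_) fun x hx => ?_
  · exact (hasDerivAt_V_axis μ ⟨hx.1, hx.2.trans_lt hl.2⟩).continuousAt.continuousWithinAt
  · rw [interior_Ioc] at hx
    rw [(hasDerivAt_V_axis μ ⟨hx.1, hx.2.trans hl.2⟩).deriv]
    refine Vx_pos hμ hl h (mk_ne_origin hx.1) ?_ hx.1.le
    rw [nrm_mk_zero, abs_of_pos hx.1]
    exact hx.2

theorem V_axis_le {μ x : ℝ} (hμ : μ ∈ Ioo (0 : ℝ) 1) (hx : x ∈ Ioo (0 : ℝ) 1) :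
    V μ (x, 0) ≤ -((1 - μ) / x) := by
  rw [V_axis hx]
  have h1 : 0 ≤ μ / (1 - x) := div_nonneg hμ.1.le (by linarith [hx.2])
  have h2 := sq_nonneg (x - μ)
  linarith

theorem exists_belowCritical {μ c : ℝ} (hμ : μ ∈ Ioo (0 : ℝ) 1) (hc : c < firstCriticalValue μ) :
    ∃ l a, BelowCritical μ c l a := by
  obtain ⟨l, hl, hcrit⟩ := exists_lagrange_point hμ
  have hcl : c < V μ (l, 0) := hc.trans_le (firstCriticalValue_le hμ hl hcrit)
  have hmono := strictMonoOn_V_axis hμ hl hcrit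
  have hm : 0 < 1 - μ := sub_pos.2 hμ.2
  have hd : 0 < |c| + 1 := by positivity
  set b : ℝ := min l ((1 - μ) / (|c| + 1)) with hb
  have hb0 : 0 < b := lt_min hl.1 (by positivity)
  have hbl : b ≤ l := min_le_left _ _
  have hVb : V μ (b, 0) < c := by
    refine (V_axis_le hμ ⟨hb0, hbl.trans_lt hl.2⟩).trans_lt ?_
    have h1 : |c| + 1 ≤ (1 - μ) / b := by
      rw [le_div_iff₀ hb0, mul_comm, ← le_div_iff₀ hd]
      exact min_le_right _ _
    linarith [neg_abs_le c]
  have hcont : ContinuousOn (fun x => V μ (x, 0)) (Icc b l) := fun x hx =>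
    (hasDerivAt_V_axis μ ⟨hb0.trans_le hx.1, hx.2.trans_lt hl.2⟩).continuousAt.continuousWithinAt
  obtain ⟨a, ha, hVa⟩ := intermediate_value_Ioo hbl hcont ⟨hVb, hcl⟩
  have ha0 : 0 < a := hb0.trans ha.1
  refine ⟨l, a, hμ, hl, hcrit, hcl, ⟨ha0, ha.2⟩, hVa, fun x hx => ?_⟩
  rw [← hVa]
  exact hmono ⟨hx.1, (hx.2.trans ha.2).le⟩ ⟨ha0, ha.2.le⟩ hx.2

/-- The speed at `(s, 0)` on the energy level `c`. -/
noncomputable def speed (μ c s : ℝ) : ℝ := Real.sqrt (2 * (c - V μ (s, 0)))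

/-- The point over `(s, 0)` whose velocity is perpendicular to the axis, with energy `c`. -/
noncomputable def start (μ c s : ℝ) : (ℝ × ℝ) × (ℝ × ℝ) := ((s, 0), (0, -speed μ c s))

/-- The trajectory on `[0, T]` with initial condition `start μ c s`. -/
structure IsTraj (μ c s T : ℝ) (γ : ℝ → (ℝ × ℝ) × (ℝ × ℝ)) : Prop where
  sol : IsSol (field μ) dom T γ
  eq_start : γ 0 = start μ c s

theorem hasDerivAt_components {μ t : ℝ} {γ : ℝ → (ℝ × ℝ) × (ℝ × ℝ)}
    (h : HasDerivAt γ (field μ (γ t)) t) :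
    HasDerivAt (fun t => (γ t).1.1) (γ t).2.1 t ∧ HasDerivAt (fun t => (γ t).1.2) (γ t).2.2 t ∧
    HasDerivAt (fun t => (γ t).2.1) (2 * (γ t).2.2 - Vx μ (γ t).1) t ∧
    HasDerivAt (fun t => (γ t).2.2) (-2 * (γ t).2.1 - Vy μ (γ t).1) t :=
  ⟨h.fst.fst, h.fst.snd, h.snd.fst, h.snd.snd⟩

section

variable {μ c l a s T : ℝ} {γ : ℝ → (ℝ × ℝ) × (ℝ × ℝ)}

theorem BelowCritical.speed_sq (B : BelowCritical μ c l a) (hs : s ∈ Ioo 0 a) :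
    speed μ c s ^ 2 = 2 * (c - V μ (s, 0)) :=
  Real.sq_sqrt (by linarith [B.V_lt s hs])

theorem BelowCritical.speed_pos (B : BelowCritical μ c l a) (hs : s ∈ Ioo 0 a) : 0 < speed μ c s :=
  Real.sqrt_pos.2 (by linarith [B.V_lt s hs])

theorem BelowCritical.a_lt_one (B : BelowCritical μ c l a) : a < 1 := B.ha.2.trans B.hl.2

theorem BelowCritical.continuousAt_speed (B : BelowCritical μ c l a) (hs : s ∈ Ioc 0 a) :
    ContinuousAt (speed μ c) s :=
  ((hasDerivAt_V_axis μ ⟨hs.1, hs.2.trans_lt B.a_lt_one⟩).continuousAt.const_sub c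
    |>.const_mul 2).sqrt

theorem BelowCritical.continuousAt_start (B : BelowCritical μ c l a) (hs : s ∈ Ioo 0 a) :
    ContinuousAt (start μ c) s :=
  (continuousAt_id.prodMk continuousAt_const).prodMk
    (continuousAt_const.prodMk (B.continuousAt_speed ⟨hs.1, hs.2.le⟩).neg)

theorem BelowCritical.start_mem (B : BelowCritical μ c l a) (hs : s ∈ Ioo 0 a) :
    start μ c s ∈ dom :=
  ⟨mk_ne_origin hs.1, mk_ne_one (hs.2.trans B.a_lt_one)⟩

/-- The energy is a first integral. -/
theorem IsTraj.energy (B : BelowCritical μ c l a) (hs : s ∈ Ioo 0 a) (h : IsTraj μ c s T γ) :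
    ∀ t ∈ Icc 0 T, ((γ t).2.1 ^ 2 + (γ t).2.2 ^ 2) / 2 + V μ (γ t).1 = c := by
  have hd : ∀ t ∈ Icc 0 T,
      HasDerivAt (fun t => ((γ t).2.1 ^ 2 + (γ t).2.2 ^ 2) / 2 + V μ (γ t).1) 0 t := fun t ht => by
    obtain ⟨hm, hD⟩ := h.sol t ht
    obtain ⟨-, -, hu, hw⟩ := hasDerivAt_components hD
    have hV := (hasFDerivAt_V μ hm.1 hm.2).comp_hasDerivAt t hD.fst
    refine ((((hu.pow 2).add (hw.pow 2)).div_const 2).add hV).congr_deriv ?_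
    simp [field]
    ring
  have hm := monotoneOn_of_hasDerivAt hd fun _ _ => le_rfl
  have ha := antitoneOn_of_hasDerivAt hd fun _ _ => le_rfl
  intro t ht
  have h0 : (0 : ℝ) ∈ Icc 0 T := ⟨le_rfl, ht.1.trans ht.2⟩
  have e := le_antisymm (ha h0 ht ht.1) (hm h0 ht ht.1)
  simp only [h.eq_start] at e
  rw [e]
  have := B.speed_sq hs
  simp only [start]
  linarith

/-- Trajectories stay in the disc bounded by the collinear critical point. -/
theorem IsTraj.nrm_lt (B : BelowCritical μ c l a) (hs : s ∈ Ioo 0 a) (h : IsTraj μ c s T γ) :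
    ∀ t ∈ Icc 0 T, nrm (γ t).1 < l := by
  have hn : Continuous nrm := by unfold nrm; fun_prop
  intro t ht
  by_contra! hge
  have hc : ContinuousOn (fun t => nrm (γ t).1) (Icc 0 t) :=
    hn.comp_continuousOn (continuous_fst.comp_continuousOn
      (h.sol.continuousOn.mono (Icc_subset_Icc_right ht.2)))
  have h0 : nrm (γ 0).1 ≤ l := by
    rw [h.eq_start]
    simp only [start, nrm_mk_zero, abs_of_pos hs.1]
    exact (hs.2.trans B.ha.2).le
  obtain ⟨r, hr, hrl⟩ := intermediate_value_Icc ht.1 hc ⟨h0, hge⟩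
  have h1 := h.energy B hs r ⟨hr.1, hr.2.trans ht.2⟩
  have h2 := V_le_of_circle B.hμ B.hl hrl
  have h3 := B.lt_crit
  nlinarith [sq_nonneg (γ r).2.1, sq_nonneg (γ r).2.2]

theorem IsTraj.mono {T' : ℝ} (h : IsTraj μ c s T γ) (hT : T' ≤ T) : IsTraj μ c s T' γ :=
  ⟨h.sol.mono hT, h.eq_start⟩

theorem IsTraj.unique {η : ℝ → (ℝ × ℝ) × (ℝ × ℝ)} (h : IsTraj μ c s T γ)
    (h' : IsTraj μ c s T η) : EqOn γ η (Icc 0 T) :=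
  h.sol.unique isOpen_dom (contDiffOn_field μ) h'.sol (h.eq_start.trans h'.eq_start.symm)

section Quadrant

variable (B : BelowCritical μ c l a) (hs : s ∈ Ioo 0 a) (h : IsTraj μ c s T γ)
  (hx : ∀ t ∈ Icc 0 T, 0 ≤ (γ t).1.1) (hy : ∀ t ∈ Icc 0 T, (γ t).1.2 ≤ 0)

include B hs h hx

theorem IsTraj.strictAntiOn_G :
    StrictAntiOn (fun t => (γ t).2.1 - 2 * (γ t).1.2) (Icc 0 T) := by
  refine strictAntiOn_of_hasDerivAt (f' := fun t => -Vx μ (γ t).1) (fun t ht => ?_)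
    fun t ht => ?_
  · obtain ⟨-, hy, hu, -⟩ := hasDerivAt_components (h.sol t ht).2
    exact (hu.sub (hy.const_mul 2)).congr_deriv (by ring)
  · have ht' := Ioo_subset_Icc_self ht
    exact neg_neg_of_pos (Vx_pos B.hμ B.hl B.crit (h.sol t ht').1.1
      (h.nrm_lt B hs t ht') (hx t ht'))

theorem IsTraj.u_le : ∀ t ∈ Icc 0 T, (γ t).2.1 ≤ 2 * (γ t).1.2 := fun t ht => by
  have := (h.strictAntiOn_G B hs hx).antitoneOn ⟨le_rfl, ht.1.trans ht.2⟩ ht ht.1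
  simp only [h.eq_start, start] at this
  linarith

include hy

theorem IsTraj.antitoneOn_x : AntitoneOn (fun t => (γ t).1.1) (Icc 0 T) :=
  antitoneOn_of_hasDerivAt (fun t ht => (hasDerivAt_components (h.sol t ht).2).1) fun t ht => by
    linarith [h.u_le B hs hx t ht, hy t ht]

theorem IsTraj.x_le : ∀ t ∈ Icc 0 T, (γ t).1.1 ≤ s := fun t ht => by
  have := h.antitoneOn_x B hs hx hy ⟨le_rfl, ht.1.trans ht.2⟩ ht ht.1
  simpa only [h.eq_start, start] using this

theorem IsTraj.monotoneOn_w : MonotoneOn (fun t => (γ t).2.2) (Icc 0 T) :=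
  monotoneOn_of_hasDerivAt (fun t ht => (hasDerivAt_components (h.sol t ht).2).2.2.2)
    fun t ht => by
      have h1 := Vy_nonpos B.hμ B.hl B.crit (h.sol t ht).1.1 (h.nrm_lt B hs t ht).le (hy t ht)
      linarith [h.u_le B hs hx t ht, hy t ht]

theorem IsTraj.w_pos_of_return (hT : 0 < T) (hneg : ∀ t ∈ Ioo 0 T, (γ t).1.2 < 0)
    (hyT : (γ T).1.2 = 0) : 0 < (γ T).2.2 := by
  by_contra! hw
  have hm := h.monotoneOn_w B hs hx hy
  have hTm : T ∈ Icc 0 T := ⟨hT.le, le_rfl⟩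
  have ha : AntitoneOn (fun t => (γ t).1.2) (Icc 0 T) :=
    antitoneOn_of_hasDerivAt (fun t ht => (hasDerivAt_components (h.sol t ht).2).2.1)
      fun t ht => (hm ht hTm ht.2).trans hw
  have h1 := ha (a := T / 2) ⟨by linarith, by linarith⟩ hTm (by linarith)
  have h2 := hneg (T / 2) ⟨by linarith, by linarith⟩
  simp only [hyT] at h1
  linarith

end Quadrant

/-- Trajectories enter the open fourth quadrant. -/
theorem IsTraj.exists_enter (B : BelowCritical μ c l a) (hs : s ∈ Ioo 0 a) (hT : 0 < T)
    (h : IsTraj μ c s T γ) :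
    ∃ δ ∈ Ioc 0 T, ∀ t ∈ Icc 0 δ, 0 < (γ t).1.1 ∧ (γ t).2.2 < -(speed μ c s / 2) := by
  have h0 : (0 : ℝ) ∈ Icc 0 T := ⟨le_rfl, hT.le⟩
  have hc := (h.sol 0 h0).2.continuousAt
  have hv := B.speed_pos hs
  have e1 : ∀ᶠ t in 𝓝 0, 0 < (γ t).1.1 :=
    hc.fst.fst.eventually_const_lt (by simpa only [h.eq_start, start] using hs.1)
  have e2 : ∀ᶠ t in 𝓝 0, (γ t).2.2 < -(speed μ c s / 2) :=
    hc.snd.snd.eventually_lt_const (by simp only [h.eq_start, start]; linarith)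
  obtain ⟨ε, hε, hball⟩ := Metric.eventually_nhds_iff.1 (e1.and e2)
  refine ⟨min T (ε / 2), ⟨by positivity, min_le_left _ _⟩, fun t ht => hball ?_⟩
  rw [Real.dist_eq, sub_zero, abs_of_nonneg ht.1]
  linarith [ht.2.trans (min_le_right _ _)]

theorem IsTraj.y_neg_of_w_neg {δ : ℝ} (h : IsTraj μ c s δ γ) (hw : ∀ t ∈ Icc 0 δ, (γ t).2.2 < 0) :
    ∀ t ∈ Ioc 0 δ, (γ t).1.2 < 0 := fun t ht => by
  have := strictAntiOn_of_hasDerivAt (fun t ht => (hasDerivAt_components (h.sol t ht).2).2.1)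
    (fun t ht => hw t (Ioo_subset_Icc_self ht)) ⟨le_rfl, ht.1.le.trans ht.2⟩ ⟨ht.1.le, ht.2⟩ ht.1
  simpa only [h.eq_start, start] using this

end

end Trajectory

section Outcomes

open Topology

/-- The trajectory returns to the axis on the side of `E`. -/
def Returns (μ c s : ℝ) : Prop :=
  ∃ T γ, 0 < T ∧ IsTraj μ c s T γ ∧ (∀ t ∈ Icc 0 T, 0 < (γ t).1.1) ∧ 0 < (γ T).1.2

/-- The trajectory leaves the fourth quadrant through the negative vertical half-axis. -/
def Crosses (μ c s : ℝ) : Prop :=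
  ∃ T γ, 0 < T ∧ IsTraj μ c s T γ ∧ (γ T).1.1 < 0 ∧ ∀ t ∈ Ioc 0 T, (γ t).1.2 < 0

/-- The trajectory runs into the primary `O`. -/
def Collides (μ c s : ℝ) : Prop :=
  ∃ T γ, 0 < T ∧ (∀ T' ∈ Ico 0 T, IsTraj μ c s T' γ) ∧
    Tendsto (fun t => (γ t).1) (𝓝[<] T) (𝓝 (0, 0))

variable {μ c l a s : ℝ}

theorem Returns.not_crosses (hA : Returns μ c s) : ¬ Crosses μ c s := by
  rintro ⟨T', η, hT', hη, hxT, hy⟩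
  obtain ⟨T, γ, hT, hγ, hx, hyT⟩ := hA
  rcases le_total T T' with h | h
  · have e := hγ.unique (hη.mono h) ⟨hT.le, le_rfl⟩
    rw [e] at hyT
    linarith [hy T ⟨hT, h⟩]
  · have e := hη.unique (hγ.mono h) ⟨hT'.le, le_rfl⟩
    rw [e] at hxT
    linarith [hx T' ⟨hT'.le, h⟩]

theorem abs_sub_lt_of_dist_lt {p q : (ℝ × ℝ) × (ℝ × ℝ)} {ε : ℝ} (h : dist p q < ε) :
    |p.1.1 - q.1.1| < ε ∧ |p.1.2 - q.1.2| < ε ∧ |p.2.2 - q.2.2| < ε := by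
  simp only [Prod.dist_eq, max_lt_iff, Real.dist_eq] at h
  exact ⟨h.1.1, h.1.2, h.2.2⟩

theorem IsTraj.eventually_near {T ε : ℝ} {γ : ℝ → (ℝ × ℝ) × (ℝ × ℝ)} (B : BelowCritical μ c l a)
    (hs : s ∈ Ioo 0 a) (hT : 0 ≤ T) (h : IsTraj μ c s T γ) (hε : 0 < ε) :
    ∀ᶠ r in 𝓝 s, ∃ η, IsTraj μ c r T η ∧ ∀ t ∈ Icc 0 T, |(η t).1.1 - (γ t).1.1| < ε ∧
      |(η t).1.2 - (γ t).1.2| < ε ∧ |(η t).2.2 - (γ t).2.2| < ε := by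
  obtain ⟨δ, hδ, hnear⟩ := h.sol.exists_near isOpen_dom (contDiffOn_field μ) hT hε
  have hc := (B.continuousAt_start hs).eventually (Metric.ball_mem_nhds _ hδ)
  filter_upwards [hc] with r hr
  obtain ⟨η, hη, h0, hd⟩ := hnear (start μ c r) (by rw [h.eq_start]; exact hr)
  exact ⟨η, ⟨hη, h0⟩, fun t ht => abs_sub_lt_of_dist_lt (hd t ht)⟩

theorem exists_pos_le_of_continuousOn {f : ℝ → ℝ} {a b : ℝ} (hf : ContinuousOn f (Icc a b))
    (h : ∀ t ∈ Icc a b, 0 < f t) : ∃ m > 0, ∀ t ∈ Icc a b, m ≤ f t := by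
  rcases (Icc a b).eq_empty_or_nonempty with e | hne
  · exact ⟨1, one_pos, by simp [e]⟩
  · obtain ⟨t, ht, hmin⟩ := isCompact_Icc.exists_isMinOn hne hf
    exact ⟨f t, h t ht, fun r hr => hmin hr⟩

theorem Returns.eventually (B : BelowCritical μ c l a) (hs : s ∈ Ioo 0 a) (hA : Returns μ c s) :
    ∀ᶠ r in 𝓝 s, Returns μ c r := by
  obtain ⟨T, γ, hT, hγ, hx, hyT⟩ := hA
  obtain ⟨m, hm, hmx⟩ := exists_pos_le_of_continuousOn
    (continuous_fst.comp_continuousOn (continuous_fst.comp_continuousOn hγ.sol.continuousOn)) hx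
  filter_upwards [hγ.eventually_near B hs hT.le (lt_min hm hyT)] with r ⟨η, hη, hd⟩
  refine ⟨T, η, hT, hη, fun t ht => ?_, ?_⟩
  · have h1 := (abs_lt.1 (hd t ht).1).1
    have h2 : m ≤ (γ t).1.1 := hmx t ht
    linarith [min_le_left m (γ T).1.2]
  · have h1 := (abs_lt.1 (hd T ⟨hT.le, le_rfl⟩).2.1).1
    linarith [min_le_right m (γ T).1.2]

theorem Crosses.eventually (B : BelowCritical μ c l a) (hs : s ∈ Ioo 0 a) (hB : Crosses μ c s) :
    ∀ᶠ r in 𝓝 s, Crosses μ c r := by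
  obtain ⟨T, γ, hT, hγ, hxT, hy⟩ := hB
  obtain ⟨δ, hδ, hw⟩ := hγ.exists_enter B hs hT
  have hv := B.speed_pos hs
  obtain ⟨m, hm, hmy⟩ := exists_pos_le_of_continuousOn
    ((continuous_snd.comp_continuousOn (continuous_fst.comp_continuousOn
      (hγ.sol.continuousOn.mono (Icc_subset_Icc_left hδ.1.le)))).neg)
    (fun t ht => neg_pos.2 (hy t ⟨hδ.1.trans_le ht.1, ht.2⟩))
  filter_upwards [hγ.eventually_near B hs hT.le (lt_min (half_pos hv) (lt_min hm (neg_pos.2 hxT)))]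
    with r ⟨η, hη, hd⟩
  set ε := min (speed μ c s / 2) (min m (-(γ T).1.1)) with hε
  have e1 : ε ≤ speed μ c s / 2 := min_le_left _ _
  have e2 : ε ≤ m := (min_le_right _ _).trans (min_le_left _ _)
  have e3 : ε ≤ -(γ T).1.1 := (min_le_right _ _).trans (min_le_right _ _)
  refine ⟨T, η, hT, hη, ?_, fun t ht => ?_⟩
  · have h1 := (abs_lt.1 (hd T ⟨hT.le, le_rfl⟩).1).2
    linarith
  · rcases le_total t δ with h | h
    · refine (hη.mono hδ.2).y_neg_of_w_neg (fun r hr => ?_) t ⟨ht.1, h⟩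
      have h1 := (abs_lt.1 (hd r ⟨hr.1, hr.2.trans hδ.2⟩).2.2).2
      linarith [(hw r hr).2]
    · have h1 := (abs_lt.1 (hd t ⟨ht.1.le, ht.2⟩).2.1).2
      have h2 : m ≤ -(γ t).1.2 := hmy t ⟨h, ht.2⟩
      linarith

/-- Trajectories launched close to `O` do not return to the axis. -/
theorem not_returns (B : BelowCritical μ c l a) (hs : s ∈ Ioo 0 a)
    (hv : s + 1 / (1 - l) ^ 3 / 2 ≤ speed μ c s) : ¬ Returns μ c s := by
  rintro ⟨T, γ, hT, hγ, hx, hyT⟩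
  obtain ⟨δ, hδ, hw⟩ := hγ.exists_enter B hs hT
  have hv0 := B.speed_pos hs
  have hyδ := (hγ.mono hδ.2).y_neg_of_w_neg fun t ht => by linarith [(hw t ht).2]
  have hcy : ContinuousOn (fun t => (γ t).1.2) (Icc δ T) :=
    continuous_snd.comp_continuousOn (continuous_fst.comp_continuousOn
      (hγ.sol.continuousOn.mono (Icc_subset_Icc_left hδ.1.le)))
  obtain ⟨T₁, hT₁, hy₁, hneg⟩ := exists_first_zero hδ.2 hcy (hyδ δ ⟨hδ.1, le_rfl⟩) hyT.le
  have hT₁0 : 0 < T₁ := hδ.1.trans hT₁.1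
  have h := hγ.mono hT₁.2
  have hyneg : ∀ t ∈ Ioo 0 T₁, (γ t).1.2 < 0 := fun t ht => by
    rcases le_total t δ with h | h
    · exact hyδ t ⟨ht.1, h⟩
    · exact hneg t ⟨h, ht.2⟩
  have hy : ∀ t ∈ Icc 0 T₁, (γ t).1.2 ≤ 0 := fun t ht => by
    rcases ht.1.eq_or_lt with e | e
    · rw [← e, h.eq_start]
      exact le_rfl
    · rcases ht.2.eq_or_lt with e' | e'
      · rw [e', hy₁]
      · exact (hyneg t ⟨e, e'⟩).le
  have hx' : ∀ t ∈ Icc 0 T₁, 0 ≤ (γ t).1.1 := fun t ht => (hx t ⟨ht.1, ht.2.trans hT₁.2⟩).le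
  have hw₁ := h.w_pos_of_return B hs hx' hy hT₁0 hyneg hy₁
  have hl1 : 0 < 1 - l := sub_pos.2 B.hl.2
  set C : ℝ := 1 / (1 - l) ^ 3 with hC
  have hC0 : 0 < C := by positivity
  have hanti : AntitoneOn (fun t => (γ t).1.1 * (γ t).2.2 - (γ t).1.2 * (γ t).2.1 +
      (γ t).1.1 ^ 2 + (γ t).1.2 ^ 2 + C / 2 * (γ t).1.1) (Icc 0 T₁) := by
    refine antitoneOn_of_hasDerivAt (f' := fun t =>
      μ * (γ t).1.2 * (1 - 1 / nrm ((γ t).1.1 - 1, (γ t).1.2) ^ 3) + C / 2 * (γ t).2.1)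
      (fun t ht => ?_) fun t ht => ?_
    · obtain ⟨dx, dy, du, dw⟩ := hasDerivAt_components (h.sol t ht).2
      refine (((((dx.mul dw).sub (dy.mul du)).add (dx.pow 2)).add (dy.pow 2)).add
        (dx.const_mul (C / 2))).congr_deriv ?_
      have := torque_eq μ (γ t).1
      simp only [Nat.cast_ofNat, Nat.add_one_sub_one, pow_one]
      linarith
    · have hxl : (γ t).1.1 < l :=
        (le_abs_self _).trans_lt ((abs_fst_le_nrm _).trans_lt (h.nrm_lt B hs t ht))
      have hρ : 1 - l ≤ nrm ((γ t).1.1 - 1, (γ t).1.2) := by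
        have h1 := (neg_le_abs _).trans (abs_fst_le_nrm ((γ t).1.1 - 1, (γ t).1.2))
        simp only at h1
        linarith
      have h1 : 1 / nrm ((γ t).1.1 - 1, (γ t).1.2) ^ 3 ≤ C := by
        rw [hC]
        gcongr
      have h2 := h.u_le B hs hx' t ht
      have h3 := hy t ht
      have h4 : 0 ≤ 1 / nrm ((γ t).1.1 - 1, (γ t).1.2) ^ 3 :=
        div_nonneg zero_le_one (pow_nonneg (nrm_nonneg _) 3)
      set D := 1 / nrm ((γ t).1.1 - 1, (γ t).1.2) ^ 3
      have h5 : μ * (γ t).1.2 * (1 - D) ≤ -(γ t).1.2 * C := by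
        have p1 : 0 ≤ -(γ t).1.2 * (C - D) := mul_nonneg (by linarith) (by linarith)
        have p2 : 0 ≤ -(γ t).1.2 * D := mul_nonneg (by linarith) h4
        have p3 : 0 ≤ (1 - μ) * (-(γ t).1.2 * D) := mul_nonneg (by linarith [B.hμ.2]) p2
        have p4 : 0 ≤ μ * -(γ t).1.2 := mul_nonneg B.hμ.1.le (by linarith)
        nlinarith
      nlinarith
  have h1 := hanti ⟨le_rfl, hT₁0.le⟩ ⟨hT₁0.le, le_rfl⟩ hT₁0.le
  simp only [h.eq_start, start, hy₁] at h1
  have hx₁ := hx T₁ ⟨hT₁0.le, hT₁.2⟩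
  have h2 : 0 < (γ T₁).1.1 * (γ T₁).2.2 := mul_pos hx₁ hw₁
  have h3 : 0 ≤ s * (speed μ c s - (s + C / 2)) := mul_nonneg hs.1.le (by linarith)
  nlinarith [sq_nonneg (γ T₁).1.1]

/-- Bound on the horizontal speed away from `O`. -/
theorem IsTraj.abs_u_le {T b : ℝ} {γ : ℝ → (ℝ × ℝ) × (ℝ × ℝ)} (B : BelowCritical μ c l a)
    (hs : s ∈ Ioo 0 a) (h : IsTraj μ c s T γ) (hb : 0 < b) {t : ℝ} (ht : t ∈ Icc 0 T)
    (hx : b ≤ (γ t).1.1) : |(γ t).2.1| ≤ 1 + 2 * (|c| + 1 + 1 / (1 - l) + 1 / b) := by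
  have hl1 : 0 < 1 - l := sub_pos.2 B.hl.2
  have hm1 : 0 < 1 - μ := sub_pos.2 B.hμ.2
  have hn := h.nrm_lt B hs t ht
  have he := h.energy B hs t ht
  have hxn := abs_fst_le_nrm (γ t).1
  have hxl : (γ t).1.1 < l := (le_abs_self _).trans_lt (hxn.trans_lt hn)
  have hbr : b ≤ nrm (γ t).1 := hx.trans ((le_abs_self _).trans hxn)
  have hρ : 1 - l ≤ nrm ((γ t).1.1 - 1, (γ t).1.2) := by
    have h1 := (neg_le_abs _).trans (abs_fst_le_nrm ((γ t).1.1 - 1, (γ t).1.2))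
    simp only at h1
    linarith
  have h1 : μ / nrm ((γ t).1.1 - 1, (γ t).1.2) ≤ 1 / (1 - l) := by
    have := B.hμ.2.le
    gcongr
  have h2 : (1 - μ) / nrm (γ t).1 ≤ 1 / b := by
    have : 1 - μ ≤ 1 := by linarith [B.hμ.1]
    gcongr
  have h3 := nrm_sq (γ t).1
  have h4 : nrm (γ t).1 ^ 2 ≤ 1 := by
    have := B.hl.2
    exact pow_le_one₀ (nrm_nonneg _) (by linarith)
  have h5 : ((γ t).1.1 - μ) ^ 2 + (γ t).1.2 ^ 2 ≤ 2 := by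
    have : 0 ≤ μ * (γ t).1.1 := mul_nonneg B.hμ.1.le (by linarith)
    nlinarith [B.hμ.1, B.hμ.2]
  have h6 := le_abs_self c
  simp only [V] at he
  have h7 : (γ t).2.1 ^ 2 ≤ 2 * (|c| + 1 + 1 / (1 - l) + 1 / b) := by
    nlinarith [sq_nonneg (γ t).2.2]
  have h8 : 0 < 1 / (1 - l) := by positivity
  have h9 : 0 < 1 / b := by positivity
  have h10 : 0 ≤ |c| := abs_nonneg c
  set K := |c| + 1 + 1 / (1 - l) + 1 / b
  have hK : 0 ≤ K := by positivity
  exact abs_le_of_sq_le_sq (by nlinarith) (by linarith)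

/-- Trajectories launched close to the boundary of the Hill region do not reach the vertical
axis before returning to the horizontal one. -/
theorem not_crosses (B : BelowCritical μ c l a) (hs : s ∈ Ioo 0 a) (hs' : 3 * a / 4 ≤ s) {m M : ℝ}
    (hm : m = μ * (a / 2 * ((2 - l) / (1 - l) ^ 2 - (2 - a) / (1 - a) ^ 2)))
    (hM : M = 1 + 2 * (|c| + 1 + 1 / (1 - l) + 1 / (a / 2)))
    (hv : speed μ c s < m * (a / (4 * M)) ^ 2 / 3) : ¬ Crosses μ c s := by
  rintro ⟨T, γ, hT, hγ, hxT, hyn⟩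
  have ha0 : 0 < a := hs.1.trans hs.2
  have hcx : ContinuousOn (fun t => a / 2 - (γ t).1.1) (Icc 0 T) :=
    continuousOn_const.sub
      (continuous_fst.comp_continuousOn (continuous_fst.comp_continuousOn hγ.sol.continuousOn))
  obtain ⟨T₁, hT₁, hx₁, hneg⟩ := exists_first_zero hT.le hcx
    (by simp only [hγ.eq_start, start]; linarith) (by linarith)
  have h := hγ.mono hT₁.2
  have hT₁0 := hT₁.1
  have hxa : ∀ t ∈ Icc 0 T₁, a / 2 ≤ (γ t).1.1 := fun t ht => by
    rcases ht.2.eq_or_lt with e | e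
    · rw [e]; linarith
    · linarith [hneg t ⟨ht.1, e⟩]
  have hx : ∀ t ∈ Icc 0 T₁, 0 ≤ (γ t).1.1 := fun t ht => by linarith [hxa t ht]
  have hy : ∀ t ∈ Icc 0 T₁, (γ t).1.2 ≤ 0 := fun t ht => by
    rcases ht.1.eq_or_lt with e | e
    · rw [← e, h.eq_start]
      exact le_rfl
    · exact (hyn t ⟨e, ht.2.trans hT₁.2⟩).le
  have hR := ratio_lt B.ha.2 B.hl.2
  have hm0 : 0 < m := by
    rw [hm]
    exact mul_pos B.hμ.1 (mul_pos (by linarith) (by linarith))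
  have hVx : ∀ t ∈ Icc 0 T₁, m ≤ Vx μ (γ t).1 := fun t ht => by
    have hxs := h.x_le B hs hx hy t ht
    have hxa' : (γ t).1.1 < a := hxs.trans_lt hs.2
    refine le_trans ?_ (Vx_lower B.hμ B.hl B.crit (h.sol t ht).1.1 (h.nrm_lt B hs t ht).le
      (hx t ht) (hxa'.trans B.a_lt_one))
    have h1 := ratio_lt hxa' B.a_lt_one
    rw [hm]
    have h2 := hxa t ht
    have h3 : 0 ≤ (2 - l) / (1 - l) ^ 2 - (2 - a) / (1 - a) ^ 2 := by linarith
    have h4 := hx t ht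
    have := B.hμ.1
    gcongr
  have h00 : (0 : ℝ) ∈ Icc 0 T₁ := ⟨le_rfl, hT₁0.le⟩
  have h11 : T₁ ∈ Icc 0 T₁ := ⟨hT₁0.le, le_rfl⟩
  have hu : ∀ t ∈ Icc 0 T₁, (γ t).2.1 ≤ -(m * t) := fun t ht => by
    have := antitoneOn_of_hasDerivAt (f := fun t => (γ t).2.1 - 2 * (γ t).1.2 + m * t)
      (f' := fun t => -Vx μ (γ t).1 + m) (fun t ht => by
        obtain ⟨-, dy, du, -⟩ := hasDerivAt_components (h.sol t ht).2
        exact ((du.sub (dy.const_mul 2)).add ((hasDerivAt_id t).const_mul m)).congr_deriv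
          (by ring)) (fun t ht => by linarith [hVx t ht]) h00 ht ht.1
    simp only [h.eq_start, start] at this
    linarith [hy t ht]
  have hw : ∀ t ∈ Icc 0 T₁, -speed μ c s + m * t ^ 2 ≤ (γ t).2.2 := fun t ht => by
    have := monotoneOn_of_hasDerivAt (f := fun t => (γ t).2.2 - m * t ^ 2)
      (f' := fun t => -2 * (γ t).2.1 - Vy μ (γ t).1 - m * (2 * t)) (fun t ht => by
        obtain ⟨-, -, -, dw⟩ := hasDerivAt_components (h.sol t ht).2
        exact (dw.sub ((hasDerivAt_pow 2 t).const_mul m)).congr_deriv (by simp))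
      (fun t ht => by
        have h1 := Vy_nonpos B.hμ B.hl B.crit (h.sol t ht).1.1 (h.nrm_lt B hs t ht).le (hy t ht)
        linarith [hu t ht]) h00 ht ht.1
    simp only [h.eq_start, start] at this
    linarith
  have hyT := monotoneOn_of_hasDerivAt (f := fun t => (γ t).1.2 + speed μ c s * t - m / 3 * t ^ 3)
    (f' := fun t => (γ t).2.2 + speed μ c s - m * t ^ 2) (fun t ht => by
      obtain ⟨-, dy, -, -⟩ := hasDerivAt_components (h.sol t ht).2
      exact ((dy.add ((hasDerivAt_id t).const_mul (speed μ c s))).sub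
        ((hasDerivAt_pow 3 t).const_mul (m / 3))).congr_deriv (by simp; ring))
    (fun t ht => by linarith [hw t ht]) h00 h11 hT₁0.le
  have hM0 : 0 < M := by
    have hl1 : 0 < 1 - l := sub_pos.2 B.hl.2
    rw [hM]
    positivity
  have hxT₁ := monotoneOn_of_hasDerivAt (f := fun t => (γ t).1.1 + M * t)
    (f' := fun t => (γ t).2.1 + M) (fun t ht => by
      obtain ⟨dx, -, -, -⟩ := hasDerivAt_components (h.sol t ht).2
      exact (dx.add ((hasDerivAt_id t).const_mul M)).congr_deriv (by simp))
    (fun t ht => by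
      have := h.abs_u_le B hs (half_pos ha0) ht (hxa t ht)
      rw [← hM] at this
      linarith [(abs_le.1 this).1]) h00 h11 hT₁0.le
  simp only [h.eq_start, start] at hyT hxT₁
  have hTlow : a / (4 * M) ≤ T₁ := by
    rw [div_le_iff₀ (by positivity)]
    linarith
  have hy₁ := hy T₁ h11
  have h1 : (a / (4 * M)) ^ 2 ≤ T₁ ^ 2 := by gcongr
  have h2 : m * (a / (4 * M)) ^ 2 / 3 ≤ m * T₁ ^ 2 / 3 := by gcongr
  have h3 : 0 < T₁ * (m * T₁ ^ 2 / 3 - speed μ c s) := mul_pos hT₁0 (by linarith)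
  nlinarith

end Outcomes

section Continuation

open Topology

/-- A trajectory on `[0, T]` stays in the open fourth quadrant. -/
def Stays (μ c s T : ℝ) : Prop :=
  0 < T ∧ ∃ γ, IsTraj μ c s T γ ∧ ∀ t ∈ Ioc 0 T, 0 < (γ t).1.1 ∧ (γ t).1.2 < 0

theorem exists_Icc_of_eventually {P : ℝ → Prop} {T δ : ℝ} (h : ∀ᶠ t in 𝓝 T, P t) (hδ : 0 < δ) :
    ∃ T' ∈ Ioc T (T + δ), ∀ t ∈ Icc T T', P t := by
  obtain ⟨ε, hε, hball⟩ := Metric.eventually_nhds_iff.1 h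
  have h1 := min_le_left δ (ε / 2)
  have h2 := min_le_right δ (ε / 2)
  have h3 : 0 < min δ (ε / 2) := by positivity
  refine ⟨T + min δ (ε / 2), ⟨by linarith, by linarith⟩, fun t ht => hball ?_⟩
  rw [Real.dist_eq, abs_of_nonneg (by linarith [ht.1])]
  linarith [ht.2]

variable {μ c l a s T : ℝ}

theorem IsTraj.quadrant_le {γ : ℝ → (ℝ × ℝ) × (ℝ × ℝ)} (hT : 0 < T)
    (h : IsTraj μ c s T γ)
    (hq : ∀ t ∈ Ioo 0 T, 0 < (γ t).1.1 ∧ (γ t).1.2 < 0) :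
    (∀ t ∈ Icc 0 T, 0 ≤ (γ t).1.1) ∧ ∀ t ∈ Icc 0 T, (γ t).1.2 ≤ 0 := by
  have hcl : closure (Ioo 0 T) = Icc 0 T := closure_Ioo hT.ne
  have hc := continuous_fst.comp_continuousOn h.sol.continuousOn
  rw [← hcl] at hc ⊢
  refine ⟨fun t ht => ?_, fun t ht => ?_⟩
  · exact le_on_closure (f := fun _ => (0 : ℝ)) (g := fun t => (γ t).1.1)
      (fun t ht => (hq t ht).1.le) continuousOn_const (continuous_fst.comp_continuousOn hc) ht
  · exact le_on_closure (g := fun _ => (0 : ℝ)) (f := fun t => (γ t).1.2)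
      (fun t ht => (hq t ht).2.le) (continuous_snd.comp_continuousOn hc) continuousOn_const ht

/-- How a trajectory can continue after being in the fourth quadrant up to time `T`. -/
theorem IsTraj.continuation {δ : ℝ} {γ : ℝ → (ℝ × ℝ) × (ℝ × ℝ)} (B : BelowCritical μ c l a)
    (hs : s ∈ Ioo 0 a) (hT : 0 < T) (hδ : 0 < δ) (h : IsTraj μ c s (T + δ) γ)
    (hq : ∀ t ∈ Ioo 0 T, 0 < (γ t).1.1 ∧ (γ t).1.2 < 0) :
    Returns μ c s ∨ Crosses μ c s ∨ ∃ T' > T, Stays μ c s T' := by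
  have h' : IsTraj μ c s T γ := h.mono (by linarith)
  obtain ⟨hx, hy⟩ := h'.quadrant_le hT hq
  have hTT : T ∈ Icc 0 T := ⟨hT.le, le_rfl⟩
  have hcont := (h'.sol T hTT).2.continuousAt
  have hlt : ∀ {t T'}, t ∈ Icc T T' → T' ≤ T + δ → t ∈ Icc 0 (T + δ) := fun ht hT' =>
    ⟨hT.le.trans ht.1, ht.2.trans hT'⟩
  rcases (hx T hTT).eq_or_lt with hx0 | hx0
  · have hyT : (γ T).1.2 < 0 := lt_of_le_of_ne (hy T hTT) fun e =>
      (h'.sol T hTT).1.1 (Prod.ext hx0.symm e)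
    have huT : (γ T).2.1 < 0 := by linarith [h'.u_le B hs hx T hTT]
    obtain ⟨T', hT', hev⟩ := exists_Icc_of_eventually
      ((hcont.snd.fst.eventually_lt_const huT).and (hcont.fst.snd.eventually_lt_const hyT)) hδ
    refine Or.inr (Or.inl ⟨T', γ, hT.trans hT'.1, h.mono hT'.2, ?_, fun t ht => ?_⟩)
    · have := strictAntiOn_of_hasDerivAt
        (fun t ht => (hasDerivAt_components (h.sol t (hlt ht hT'.2)).2).1)
        (fun t ht => (hev t (Ioo_subset_Icc_self ht)).1) ⟨le_rfl, hT'.1.le⟩ ⟨hT'.1.le, le_rfl⟩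
        hT'.1
      simpa only [← hx0] using this
    · rcases lt_or_ge t T with h1 | h1
      · exact (hq t ⟨ht.1, h1⟩).2
      · exact (hev t ⟨h1, ht.2⟩).2
  · have hx00 : 0 < (γ 0).1.1 := by simpa only [h.eq_start, start] using hs.1
    rcases (hy T hTT).eq_or_lt with hy0 | hy0
    · have hwT := h'.w_pos_of_return B hs hx hy hT (fun t ht => (hq t ht).2) hy0
      obtain ⟨T', hT', hev⟩ := exists_Icc_of_eventually
        ((hcont.snd.snd.eventually_const_lt hwT).and (hcont.fst.fst.eventually_const_lt hx0)) hδ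
      refine Or.inl ⟨T', γ, hT.trans hT'.1, h.mono hT'.2, fun t ht => ?_, ?_⟩
      · rcases ht.1.eq_or_lt with h0 | h0
        · rwa [← h0]
        rcases lt_or_ge t T with h1 | h1
        · exact (hq t ⟨h0, h1⟩).1
        · exact (hev t ⟨h1, ht.2⟩).2
      · have := strictAntiOn_of_hasDerivAt (f := fun t => -(γ t).1.2) (f' := fun t => -(γ t).2.2)
          (fun t ht => (hasDerivAt_components (h.sol t (hlt ht hT'.2)).2).2.1.neg)
          (fun t ht => neg_neg_of_pos (hev t (Ioo_subset_Icc_self ht)).1) ⟨le_rfl, hT'.1.le⟩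
          ⟨hT'.1.le, le_rfl⟩ hT'.1
        simp only [hy0] at this
        linarith
    · obtain ⟨T', hT', hev⟩ := exists_Icc_of_eventually
        ((hcont.fst.fst.eventually_const_lt hx0).and (hcont.fst.snd.eventually_lt_const hy0)) hδ
      refine Or.inr (Or.inr ⟨T', hT'.1, hT.trans hT'.1, γ, h.mono hT'.2, fun t ht => ?_⟩)
      rcases lt_or_ge t T with h1 | h1
      · exact hq t ⟨ht.1, h1⟩
      · exact hev t ⟨h1, ht.2⟩

theorem exists_tendsto_of_antitoneOn {f : ℝ → ℝ} {a b m : ℝ} (hab : a < b)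
    (hf : AntitoneOn f (Ioo a b)) (hm : ∀ t ∈ Ioo a b, m ≤ f t) :
    ∃ L, Tendsto f (𝓝[<] b) (𝓝 L) :=
  ⟨_, hf.tendsto_nhdsWithin_Ioo_left (nonempty_Ioo.2 hab)
    ⟨m, by rintro _ ⟨t, ht, rfl⟩; exact hm t ht⟩⟩

theorem exists_tendsto_of_monotoneOn {f : ℝ → ℝ} {a b m : ℝ} (hab : a < b)
    (hf : MonotoneOn f (Ioo a b)) (hm : ∀ t ∈ Ioo a b, f t ≤ m) :
    ∃ L, Tendsto f (𝓝[<] b) (𝓝 L) :=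
  ⟨_, hf.tendsto_nhdsWithin_Ioo_left (nonempty_Ioo.2 hab)
    ⟨m, by rintro _ ⟨t, ht, rfl⟩; exact hm t ht⟩⟩

theorem collides_or_extends {Γ : ℝ → (ℝ × ℝ) × (ℝ × ℝ)} (B : BelowCritical μ c l a)
    (hs : s ∈ Ioo 0 a) (hT : 0 < T) (h : ∀ T' ∈ Ico 0 T, IsTraj μ c s T' Γ)
    (hq : ∀ t ∈ Ioo 0 T, 0 < (Γ t).1.1 ∧ (Γ t).1.2 < 0) :
    Collides μ c s ∨ ∃ δ > 0, ∃ η, IsTraj μ c s (T + δ) η ∧ ∀ t < T, η t = Γ t := by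
  have hT' : ∀ t ∈ Ioo 0 T, t ∈ Ico 0 T := fun t ht => ⟨ht.1.le, ht.2⟩
  have hmem : ∀ t ∈ Ioo 0 T, t ∈ Icc 0 t := fun t ht => ⟨ht.1.le, le_rfl⟩
  have hqle : ∀ t ∈ Ioo 0 T, _ := fun t ht => (h t (hT' t ht)).quadrant_le ht.1
    fun r hr => hq r ⟨hr.1, hr.2.trans ht.2⟩
  have hxanti : AntitoneOn (fun t => (Γ t).1.1) (Ioo 0 T) := fun r hr t ht hrt =>
    (h t (hT' t ht)).antitoneOn_x B hs (hqle t ht).1 (hqle t ht).2 ⟨hr.1.le, hrt⟩ (hmem t ht) hrt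
  have hwmono : MonotoneOn (fun t => (Γ t).2.2) (Ioo 0 T) := fun r hr t ht hrt =>
    (h t (hT' t ht)).monotoneOn_w B hs (hqle t ht).1 (hqle t ht).2 ⟨hr.1.le, hrt⟩ (hmem t ht) hrt
  have hGanti : AntitoneOn (fun t => (Γ t).2.1 - 2 * (Γ t).1.2) (Ioo 0 T) := fun r hr t ht hrt =>
    ((h t (hT' t ht)).strictAntiOn_G B hs (hqle t ht).1).antitoneOn ⟨hr.1.le, hrt⟩ (hmem t ht) hrt
  have hxs : ∀ t ∈ Ioo 0 T, (Γ t).1.1 ≤ s := fun t ht =>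
    (h t (hT' t ht)).x_le B hs (hqle t ht).1 (hqle t ht).2 t (hmem t ht)
  have hdy : ∀ t ∈ Ioo 0 T, HasDerivAt (fun t => (Γ t).1.2) (Γ t).2.2 t := fun t ht =>
    (hasDerivAt_components ((h t (hT' t ht)).sol t (hmem t ht)).2).2.1
  obtain ⟨X, hX⟩ := exists_tendsto_of_antitoneOn hT hxanti fun t ht => (hq t ht).1.le
  obtain ⟨Y, hY⟩ : ∃ Y, Tendsto (fun t => (Γ t).1.2) (𝓝[<] T) (𝓝 Y) := by
    by_cases hw : ∃ t₁ ∈ Ioo 0 T, 0 ≤ (Γ t₁).2.2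
    · obtain ⟨t₁, ht₁, hw₁⟩ := hw
      refine exists_tendsto_of_monotoneOn ht₁.2 (fun r hr t ht hrt => ?_)
        fun t ht => (hq t ⟨ht₁.1.trans ht.1, ht.2⟩).2.le
      have hsub : ∀ x ∈ Icc r t, x ∈ Ioo 0 T := fun x hx =>
        ⟨ht₁.1.trans (hr.1.trans_le hx.1), hx.2.trans_lt ht.2⟩
      exact monotoneOn_of_hasDerivAt (fun x hx => hdy x (hsub x hx))
        (fun x hx => hw₁.trans (hwmono ht₁ (hsub x hx) (hr.1.le.trans hx.1)))
        ⟨le_rfl, hrt⟩ ⟨hrt, le_rfl⟩ hrt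
    · push Not at hw
      refine exists_tendsto_of_antitoneOn hT (m := -1) (fun r hr t ht hrt => ?_) fun t ht => ?_
      · have hsub : ∀ x ∈ Icc r t, x ∈ Ioo 0 T := fun x hx =>
          ⟨hr.1.trans_le hx.1, hx.2.trans_lt ht.2⟩
        exact antitoneOn_of_hasDerivAt (fun x hx => hdy x (hsub x hx))
          (fun x hx => (hw x (hsub x hx)).le) ⟨le_rfl, hrt⟩ ⟨hrt, le_rfl⟩ hrt
      · have h1 := (h t (hT' t ht)).nrm_lt B hs t (hmem t ht)
        have h2 := nrm_sq (Γ t).1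
        have h3 := nrm_nonneg (Γ t).1
        have h4 := B.hl.2
        by_contra! h5
        nlinarith [sq_nonneg (Γ t).1.1]
  have hXY : Tendsto (fun t => (Γ t).1) (𝓝[<] T) (𝓝 (X, Y)) := hX.prodMk_nhds hY
  by_cases hO : ((X, Y) : ℝ × ℝ) = (0, 0)
  · exact Or.inl ⟨T, Γ, hT, h, hO ▸ hXY⟩
  have hIoo : Ioo 0 T ∈ 𝓝[<] T := Ioo_mem_nhdsLT hT
  have hXs : X ≤ s := le_of_tendsto hX (mem_of_superset hIoo hxs)
  have hE : ((X, Y) : ℝ × ℝ) ≠ (1, 0) := fun e => by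
    have := (Prod.mk.inj e).1
    linarith [hs.2, B.a_lt_one]
  have hV := ((hasFDerivAt_V μ hO hE).continuousAt.tendsto.comp hXY).eventually_const_lt
    (sub_one_lt (V μ (X, Y)))
  obtain ⟨t₂, ht₂, hb⟩ := (mem_nhdsLT_iff_exists_Ioo_subset' hT).1 (inter_mem hV hIoo)
  have hsub : ∀ t ∈ Ioo t₂ T, t ∈ Ioo 0 T := fun t ht => (hb ht).2
  obtain ⟨K, hK⟩ : ∃ K, ∀ t ∈ Ioo t₂ T, |(Γ t).2.1| ≤ K ∧ |(Γ t).2.2| ≤ K := by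
    refine ⟨2 * |c - V μ (X, Y) + 1| + 1, fun t ht => ?_⟩
    have h1 := (h t (hT' t (hsub t ht))).energy B hs t (hmem t (hsub t ht))
    have h2 : V μ (X, Y) - 1 < V μ (Γ t).1 := (hb ht).1
    have h3 := le_abs_self (c - V μ (X, Y) + 1)
    have h4 := abs_nonneg (c - V μ (X, Y) + 1)
    constructor <;> refine abs_le_of_sq_le_sq ?_ (by linarith) <;>
      nlinarith [sq_nonneg (Γ t).2.1, sq_nonneg (Γ t).2.2]
  obtain ⟨W, hW⟩ := exists_tendsto_of_monotoneOn ht₂ (hwmono.mono hsub)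
    fun t ht => (le_abs_self _).trans (hK t ht).2
  obtain ⟨g, hg⟩ := exists_tendsto_of_antitoneOn (m := -K) ht₂ (hGanti.mono hsub) fun t ht => by
    linarith [(neg_abs_le (Γ t).2.1), (hK t ht).1, (hq t (hsub t ht)).2]
  have hU : Tendsto (fun t => (Γ t).2.1) (𝓝[<] T) (𝓝 (g + 2 * Y)) :=
    (hg.add (hY.const_mul 2)).congr fun t => by ring
  obtain ⟨δ, hδ, η, hη, he⟩ := exists_extension (p := ((X, Y), (g + 2 * Y, W))) isOpen_dom
    (contDiffOn_field μ) hT (fun t ht => (h t ht).sol t ⟨ht.1, le_rfl⟩) ⟨hO, hE⟩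
    (hXY.prodMk_nhds (hU.prodMk_nhds hW))
  exact Or.inr ⟨δ, hδ, η, ⟨hη, (he 0 hT).trans (h 0 ⟨le_rfl, hT⟩).eq_start⟩, he⟩

theorem exists_stays (B : BelowCritical μ c l a) (hs : s ∈ Ioo 0 a) : ∃ T, Stays μ c s T := by
  obtain ⟨δ, hδ, γ, hγ, h0⟩ := exists_isSol isOpen_dom (contDiffOn_field μ) (B.start_mem hs)
  have h : IsTraj μ c s δ γ := ⟨hγ, h0⟩
  obtain ⟨ε, hε, hw⟩ := h.exists_enter B hs hδ
  have hv := B.speed_pos hs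
  exact ⟨ε, hε.1, γ, h.mono hε.2, fun t ht => ⟨(hw t ⟨ht.1.le, ht.2⟩).1,
    (h.mono hε.2).y_neg_of_w_neg (fun t ht => by linarith [(hw t ht).2]) t ht⟩⟩

theorem bddAbove_stays (B : BelowCritical μ c l a) (hs : s ∈ Ioo 0 a) :
    BddAbove {T | Stays μ c s T} := by
  obtain ⟨T₀, hT₀, γ, hγ, hq⟩ := exists_stays B hs
  have hle := hγ.quadrant_le hT₀ fun t ht => hq t ⟨ht.1, ht.2.le⟩
  have hG := hγ.strictAntiOn_G B hs hle.1 ⟨le_rfl, hT₀.le⟩ ⟨hT₀.le, le_rfl⟩ hT₀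
  simp only [hγ.eq_start, start] at hG
  set κ := -((γ T₀).2.1 - 2 * (γ T₀).1.2) with hκ
  have hκ0 : 0 < κ := by linarith
  refine ⟨T₀ + s / κ, ?_⟩
  rintro T ⟨hT, η, hη, hqη⟩
  have hsκ : 0 < s / κ := div_pos hs.1 hκ0
  rcases le_total T T₀ with h | h
  · linarith
  have hleη := hη.quadrant_le hT fun t ht => hqη t ⟨ht.1, ht.2.le⟩
  have e := (hη.mono h).unique hγ ⟨hT₀.le, le_rfl⟩
  have hT₀m : T₀ ∈ Icc 0 T := ⟨hT₀.le, h⟩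
  have hdec := antitoneOn_of_hasDerivAt (f := fun t => (η t).1.1 + κ * t)
    (f' := fun t => (η t).2.1 + κ) (a := T₀) (b := T) (fun t ht =>
      ((hasDerivAt_components (hη.sol t ⟨hT₀.le.trans ht.1, ht.2⟩).2).1.add
        ((hasDerivAt_id t).const_mul κ)).congr_deriv (by simp))
    (fun t ht => by
      have ht' : t ∈ Icc 0 T := ⟨hT₀.le.trans ht.1, ht.2⟩
      have h1 := (hη.strictAntiOn_G B hs hleη.1).antitoneOn hT₀m ht' ht.1
      simp only [e] at h1
      linarith [hleη.2 t ht']) ⟨le_rfl, h⟩ ⟨h, le_rfl⟩ h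
  have h1 := hη.x_le B hs hleη.1 hleη.2 T₀ hT₀m
  have h2 := (hqη T ⟨hT, le_rfl⟩).1
  simp only at hdec
  have h3 : κ * (T - T₀) ≤ s := by linarith
  have h4 : T - T₀ ≤ s / κ := by
    rw [le_div_iff₀ hκ0]
    linarith
  linarith

/-- Every trajectory leaves the fourth quadrant through the boundary, or collides with `O`. -/
theorem returns_or_crosses_or_collides (B : BelowCritical μ c l a) (hs : s ∈ Ioo 0 a) :
    Returns μ c s ∨ Crosses μ c s ∨ Collides μ c s := by
  have hbdd := bddAbove_stays B hs
  obtain ⟨T₀, hT₀⟩ := exists_stays B hs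
  set S := sSup {T | Stays μ c s T} with hS
  have hS0 : 0 < S := hT₀.1.trans_le (le_csSup hbdd hT₀)
  have hlt : ∀ T < S, ∃ γ, IsTraj μ c s T γ ∧ ∀ t ∈ Ioc 0 T, 0 < (γ t).1.1 ∧ (γ t).1.2 < 0 := by
    intro T hT
    obtain ⟨T', ⟨-, γ, hγ, hq⟩, hTT'⟩ := exists_lt_of_lt_csSup ⟨T₀, hT₀⟩ hT
    exact ⟨γ, hγ.mono hTT'.le, fun t ht => hq t ⟨ht.1, ht.2.trans hTT'.le⟩⟩
  obtain ⟨Γ, hΓ0, hΓ⟩ := exists_glue isOpen_dom (contDiffOn_field μ) (p := start μ c s)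
    (fun T hT => (hlt T hT.2).imp fun γ hγ => ⟨hγ.1.sol, hγ.1.eq_start⟩) hS0
  have hΓ' : ∀ T ∈ Ico 0 S, IsTraj μ c s T Γ := fun T hT => ⟨hΓ T hT, hΓ0⟩
  have hq : ∀ t ∈ Ioo 0 S, 0 < (Γ t).1.1 ∧ (Γ t).1.2 < 0 := fun t ht => by
    obtain ⟨γ, hγ, hqγ⟩ := hlt t ht.2
    rw [(hΓ' t ⟨ht.1.le, ht.2⟩).unique hγ ⟨ht.1.le, le_rfl⟩]
    exact hqγ t ⟨ht.1, le_rfl⟩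
  rcases collides_or_extends B hs hS0 hΓ' hq with hC | ⟨δ, hδ, η, hη, he⟩
  · exact Or.inr (Or.inr hC)
  rcases hη.continuation B hs hS0 hδ (fun t ht => by rw [he t ht.2]; exact hq t ht)
    with hA | hB | ⟨T', hT', hstay⟩
  · exact Or.inl hA
  · exact Or.inr (Or.inl hB)
  · exact absurd (le_csSup hbdd hstay) (not_le.2 hT')

end Continuation

section Collision

open Topology

variable {μ c l a s : ℝ}

theorem exists_not_returns (B : BelowCritical μ c l a) : ∃ s ∈ Ioo 0 a, ¬ Returns μ c s := by
  have hl1 : 0 < 1 - l := sub_pos.2 B.hl.2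
  have hm1 : 0 < 1 - μ := sub_pos.2 B.hμ.2
  set C : ℝ := 1 / (1 - l) ^ 3 with hC
  have hC0 : 0 < C := by positivity
  set N : ℝ := (1 + C / 2) ^ 2 / 2 + |c| with hN
  have hN0 : 0 < N := by positivity
  have ha0 := B.ha.1
  set s : ℝ := min (a / 2) ((1 - μ) / N) with hs
  have hs0 : 0 < s := by positivity
  have hsa : s < a := (min_le_left _ _).trans_lt (by linarith)
  have hs1 : s < 1 := hsa.trans B.a_lt_one
  refine ⟨s, ⟨hs0, hsa⟩, not_returns B ⟨hs0, hsa⟩ ?_⟩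
  have h1 := V_axis_le B.hμ ⟨hs0, hs1⟩
  have h2 : N ≤ (1 - μ) / s := by
    rw [le_div_iff₀ hs0, mul_comm, ← le_div_iff₀ hN0]
    exact min_le_right _ _
  calc s + C / 2 ≤ 1 + C / 2 := by linarith
    _ ≤ speed μ c s := Real.le_sqrt_of_sq_le (by linarith [neg_abs_le c])

theorem exists_not_crosses (B : BelowCritical μ c l a) : ∃ s ∈ Ioo 0 a, ¬ Crosses μ c s := by
  have ha0 := B.ha.1
  have hl1 : 0 < 1 - l := sub_pos.2 B.hl.2
  set m : ℝ := μ * (a / 2 * ((2 - l) / (1 - l) ^ 2 - (2 - a) / (1 - a) ^ 2)) with hm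
  set M : ℝ := 1 + 2 * (|c| + 1 + 1 / (1 - l) + 1 / (a / 2)) with hM
  have hm0 : 0 < m :=
    mul_pos B.hμ.1 (mul_pos (half_pos ha0) (sub_pos.2 (ratio_lt B.ha.2 B.hl.2)))
  have hM0 : 0 < M := by positivity
  have hva : speed μ c a = 0 := by simp [speed, B.V_eq]
  have h1 : ∀ᶠ s in 𝓝[<] a, speed μ c s < m * (a / (4 * M)) ^ 2 / 3 :=
    ((B.continuousAt_speed ⟨ha0, le_rfl⟩).mono_left nhdsWithin_le_nhds).eventually_lt_const
      (by rw [hva]; positivity)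
  have h2 : Ioo (3 * a / 4) a ∈ 𝓝[<] a := Ioo_mem_nhdsLT (by linarith)
  obtain ⟨s, hv, hs⟩ := (h1.and h2).exists
  have hs0 : s ∈ Ioo 0 a := ⟨by linarith [hs.1], hs.2⟩
  exact ⟨s, hs0, not_crosses B hs0 hs.1.le hm hM hv⟩

/-- The shooting argument: some trajectory collides with `O`. -/
theorem exists_collides (B : BelowCritical μ c l a) : ∃ s ∈ Ioo 0 a, Collides μ c s := by
  by_contra! hno
  have hcover : ∀ s ∈ Ioo 0 a, Returns μ c s ∨ Crosses μ c s := fun s hs => by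
    rcases returns_or_crosses_or_collides B hs with h | h | h
    · exact Or.inl h
    · exact Or.inr h
    · exact absurd h (hno s hs)
  have hopen : ∀ {P : ℝ → Prop}, (∀ s ∈ Ioo 0 a, P s → ∀ᶠ r in 𝓝 s, P r) →
      IsOpen {s | s ∈ Ioo 0 a ∧ P s} := fun hP => isOpen_iff_mem_nhds.2 fun s hs =>
    inter_mem (Ioo_mem_nhds hs.1.1 hs.1.2) (hP s hs.1 hs.2)
  obtain ⟨s₁, hs₁, h₁⟩ := exists_not_returns B
  obtain ⟨s₂, hs₂, h₂⟩ := exists_not_crosses B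
  obtain ⟨s, -, ⟨-, hA⟩, -, hB⟩ := isPreconnected_Ioo
    _ _ (hopen fun s hs h => h.eventually B hs) (hopen fun s hs h => h.eventually B hs)
    (fun s hs => (hcover s hs).imp (fun h => ⟨hs, h⟩) fun h => ⟨hs, h⟩)
    ⟨s₂, hs₂, hs₂, (hcover s₂ hs₂).resolve_right h₂⟩
    ⟨s₁, hs₁, hs₁, (hcover s₁ hs₁).resolve_left h₁⟩
  exact hA.not_crosses hB

theorem isCCO_of_integral_curve {τ : ℝ} {σ : ℝ → (ℝ × ℝ) × (ℝ × ℝ)} (hτ : 0 < τ)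
    (hσ : ∀ t ∈ Ioo 0 τ, σ t ∈ dom ∧ HasDerivAt σ (field μ (σ t)) t)
    (hE : ∀ t ∈ Ioo 0 τ, ((σ t).2.1 ^ 2 + (σ t).2.2 ^ 2) / 2 + V μ (σ t).1 = c)
    (h0 : Tendsto (fun t => (σ t).1) (𝓝[>] 0) (𝓝 (0, 0)))
    (hτ0 : Tendsto (fun t => (σ t).1) (𝓝[<] τ) (𝓝 (0, 0))) :
    IsCCO μ c τ fun t => (σ t).1 := by
  have hc : ContinuousOn σ (Ioo 0 τ) := fun t ht =>
    (hσ t ht).2.continuousAt.continuousWithinAt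
  have hsub : (fun t => (σ t).1) '' Ioo 0 τ ⊆ Hill μ c := by
    rintro _ ⟨t, ht, rfl⟩
    have := hE t ht
    exact ⟨(hσ t ht).1.1, (hσ t ht).1.2, by nlinarith [sq_nonneg (σ t).2.1, sq_nonneg (σ t).2.2]⟩
  have hconn : IsPreconnected ((fun t => (σ t).1) '' Ioo 0 τ) :=
    isPreconnected_Ioo.image _ (continuous_fst.comp_continuousOn hc)
  refine ⟨hτ, fun t => (σ t).2, fun t => (field μ (σ t)).2, fun t ht => (hσ t ht).2.fst,
    fun t ht => (hσ t ht).2.snd, ?_, fun t ht => ⟨hsub ⟨t, ht, rfl⟩, ?_⟩, fun t ht => ?_,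
    fun t ht => ?_, h0, hτ0⟩
  · exact continuous_snd.comp_continuousOn
      ((contDiffOn_field μ).continuousOn.comp hc fun t ht => (hσ t ht).1)
  · refine closure_mono (hconn.subset_connectedComponentIn ⟨t, ht, rfl⟩ hsub) ?_
    exact mem_closure_of_tendsto h0
      (mem_of_superset (Ioo_mem_nhdsGT hτ) fun r hr => ⟨r, hr, rfl⟩)
  · rw [(hasFDerivAt_V μ (hσ t ht).1.1 (hσ t ht).1.2).fderiv]
    constructor
    · simp [field]
    · simp [field]
      ring
  · rw [nrm_sq]
    exact hE t ht

/-- The phase space reflection reversing the flow. -/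
def reflect (p : (ℝ × ℝ) × (ℝ × ℝ)) : (ℝ × ℝ) × (ℝ × ℝ) := ((p.1.1, -p.1.2), (-p.2.1, p.2.2))

theorem hasDerivAt_reflect {t : ℝ} {γ : ℝ → (ℝ × ℝ) × (ℝ × ℝ)}
    (h : HasDerivAt γ (field μ (γ (-t))) (-t)) :
    HasDerivAt (fun t => reflect (γ (-t))) (field μ (reflect (γ (-t)))) t := by
  obtain ⟨dx, dy, du, dw⟩ := hasDerivAt_components h
  have hn := hasDerivAt_neg t
  refine (((dx.comp t hn).prodMk (dy.comp t hn).neg).prodMk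
    ((du.comp t hn).neg.prodMk (dw.comp t hn))).congr_deriv ?_
  simp only [field, reflect, Vx, Vy, nrm, neg_sq, Prod.mk.injEq]
  refine ⟨⟨?_, ?_⟩, ?_, ?_⟩ <;> ring

/-- Extension of a curve to negative times by the reversing reflection. -/
noncomputable def double (γ : ℝ → (ℝ × ℝ) × (ℝ × ℝ)) (t : ℝ) : (ℝ × ℝ) × (ℝ × ℝ) :=
  if t < 0 then reflect (γ (-t)) else γ t

theorem hasDerivAt_double {T t : ℝ} {γ : ℝ → (ℝ × ℝ) × (ℝ × ℝ)}
    (h : ∀ t ∈ Ico 0 T, γ t ∈ dom ∧ HasDerivAt γ (field μ (γ t)) t)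
    (h0 : reflect (γ 0) = γ 0) (ht : t ∈ Ioo (-T) T) :
    double γ t ∈ dom ∧ HasDerivAt (double γ) (field μ (double γ t)) t := by
  rcases lt_trichotomy t 0 with hlt | rfl | hgt
  · obtain ⟨⟨hm0, hm1⟩, hd⟩ := h (-t) ⟨by linarith, by linarith [ht.1]⟩
    have e : double γ t = reflect (γ (-t)) := if_pos hlt
    rw [e]
    refine ⟨⟨fun e => hm0 ?_, fun e => hm1 ?_⟩, (hasDerivAt_reflect hd).congr_of_eventuallyEq ?_⟩
    · simp only [reflect, Prod.mk.injEq, neg_eq_zero] at e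
      exact Prod.ext e.1 e.2
    · simp only [reflect, Prod.mk.injEq, neg_eq_zero] at e
      exact Prod.ext e.1 e.2
    · filter_upwards [Iio_mem_nhds hlt] with r hr using if_pos hr
  · have e : double γ 0 = γ 0 := if_neg (lt_irrefl 0)
    obtain ⟨hm, hd⟩ := h 0 ⟨le_rfl, ht.2⟩
    rw [e]
    refine ⟨hm, ?_⟩
    have hr := hasDerivAt_reflect (μ := μ) (t := 0) (γ := γ) (by rwa [neg_zero])
    rw [neg_zero, h0] at hr
    have h1 : HasDerivWithinAt (double γ) (field μ (γ 0)) (Iic 0) 0 := by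
      refine hr.hasDerivWithinAt.congr (fun r hr => ?_) (by simp [double, h0])
      rcases (mem_Iic.1 hr).lt_or_eq with h | h
      · exact if_pos h
      · simp [double, h, h0]
    have h2 : HasDerivWithinAt (double γ) (field μ (γ 0)) (Ici 0) 0 :=
      hd.hasDerivWithinAt.congr (fun r hr => if_neg (not_lt.2 hr)) e
    have := h1.union h2
    rwa [Iic_union_Ici, hasDerivWithinAt_univ] at this
  · obtain ⟨hm, hd⟩ := h t ⟨hgt.le, ht.2⟩
    have e : double γ t = γ t := if_neg hgt.not_gt
    rw [e]
    refine ⟨hm, hd.congr_of_eventuallyEq ?_⟩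
    filter_upwards [Ioi_mem_nhds hgt] with r hr using if_neg (not_lt.2 (le_of_lt hr))

theorem Collides.exists_isCCO (B : BelowCritical μ c l a) (hs : s ∈ Ioo 0 a)
    (h : Collides μ c s) : ∃ (τ : ℝ) (q : ℝ → ℝ × ℝ), IsCCO μ c τ q := by
  obtain ⟨T, γ, hT, hγ, hlim⟩ := h
  have hsol : ∀ t ∈ Ico 0 T, γ t ∈ dom ∧ HasDerivAt γ (field μ (γ t)) t := fun t ht =>
    (hγ t ht).sol t ⟨ht.1, le_rfl⟩
  have hE : ∀ t ∈ Ico 0 T, ((γ t).2.1 ^ 2 + (γ t).2.2 ^ 2) / 2 + V μ (γ t).1 = c := fun t ht =>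
    (hγ t ht).energy B hs t ⟨ht.1, le_rfl⟩
  have h0 : reflect (γ 0) = γ 0 := by
    rw [(hγ 0 ⟨le_rfl, hT⟩).eq_start]
    simp [reflect, start]
  have hmem : ∀ t ∈ Ioo 0 (2 * T), t - T ∈ Ioo (-T) T := fun t ht =>
    ⟨by linarith [ht.1], by linarith [ht.2]⟩
  refine ⟨2 * T, _, isCCO_of_integral_curve (σ := fun t => double γ (t - T)) (by linarith)
    (fun t ht => ?_) (fun t ht => ?_) ?_ ?_⟩
  · obtain ⟨hm, hd⟩ := hasDerivAt_double hsol h0 (hmem t ht)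
    exact ⟨hm, hd.comp_sub_const t T⟩
  · rcases lt_or_ge (t - T) 0 with hlt | hge
    · have e : double γ (t - T) = reflect (γ (-(t - T))) := if_pos hlt
      have := hE (-(t - T)) ⟨by linarith, by linarith [ht.1]⟩
      simpa only [e, reflect, V, nrm, neg_sq] using this
    · have e : double γ (t - T) = γ (t - T) := if_neg (not_lt.2 hge)
      simpa only [e] using hE (t - T) ⟨hge, (hmem t ht).2⟩
  · have h1 : Tendsto (fun t => T - t) (𝓝[>] 0) (𝓝[<] T) := by
      refine tendsto_nhdsWithin_iff.2 ⟨?_, eventually_nhdsWithin_of_forall fun t ht => ?_⟩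
      · have : Tendsto (fun t : ℝ => T - t) (𝓝 0) (𝓝 (T - 0)) := tendsto_id.const_sub T
        rw [sub_zero] at this
        exact this.mono_left nhdsWithin_le_nhds
      · have := mem_Ioi.1 ht
        exact mem_Iio.2 (by linarith)
    have h2 : Tendsto (fun q : ℝ × ℝ => (q.1, -q.2)) (𝓝 (0, 0)) (𝓝 (0, 0)) := by
      have : Continuous fun q : ℝ × ℝ => (q.1, -q.2) := by fun_prop
      simpa using this.tendsto (0, 0)
    refine (h2.comp (hlim.comp h1)).congr' ?_
    filter_upwards [Ioo_mem_nhdsGT hT] with t ht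
    have e : double γ (t - T) = reflect (γ (-(t - T))) := if_pos (by linarith [ht.2])
    simp [e, reflect]
  · have h1 : Tendsto (fun t => t - T) (𝓝[<] (2 * T)) (𝓝[<] T) := by
      refine tendsto_nhdsWithin_iff.2 ⟨?_, eventually_nhdsWithin_of_forall fun t ht => ?_⟩
      · have : Tendsto (fun t : ℝ => t - T) (𝓝 (2 * T)) (𝓝 (2 * T - T)) := tendsto_id.sub_const T
        rw [two_mul, add_sub_cancel_right, ← two_mul] at this
        exact this.mono_left nhdsWithin_le_nhds
      · have := mem_Iio.1 ht
        exact mem_Iio.2 (by linarith)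
    refine (hlim.comp h1).congr' ?_
    filter_upwards [Ioo_mem_nhdsLT (show T < 2 * T by linarith)] with t ht
    have e : double γ (t - T) = γ (t - T) := if_neg (not_lt.2 (by linarith [ht.1]))
    simp [e]

end Collision

/-- Below the first critical value there exists at least one consecutive collision
orbit with energy `c`. -/
theorem pcr3bp_exists_consecutive_collision_orbit
    (μ c : ℝ) (hμ : μ ∈ Ioo (0 : ℝ) 1) (hc : c < firstCriticalValue μ) :
    ∃ (τ : ℝ) (q : ℝ → ℝ × ℝ), IsCCO μ c τ q := by
  obtain ⟨l, a, B⟩ := exists_belowCritical hμ hc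
  obtain ⟨s, hs, h⟩ := exists_collides B
  exact h.exists_isCCO B hs
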